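/- Let ε > 0, k > 1, γ > 0, and let B(N; k; γ) denote the number of quadruples of integers (n₁,n₂,n₃,n₄) with N < n_i ≤ 2N for all i and |n₁^k + n₂^k − n₃^k − n₄^k| < γ. Then B(N; k; γ) ≪_{k,ε} (N² + γ N^{4−k}) N^{ε}. -/

import Mathlib

open Real


noncomputable def ee (x : ℝ) : ℂ := Complex.exp (((2 * π * x : ℝ) : ℂ) * Complex.I)

lemma ee_norm (x : ℝ) : ‖ee x‖ = 1 := Complex.norm_exp_ofReal_mul_I _

lemma ee_add (x y : ℝ) : ee (x + y) = ee x * ee y := by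
  unfold ee; rw [← Complex.exp_add]; congr 1; push_cast; ring

lemma ee_conj (x : ℝ) : (starRingEnd ℂ) (ee x) = ee (-x) := by
  unfold ee
  rw [← Complex.exp_conj]; congr 1
  rw [map_mul, Complex.conj_ofReal, Complex.conj_I]; push_cast; ring

lemma ee_continuous : Continuous ee := by
  unfold ee; fun_prop

@[fun_prop]
lemma ee_comp_continuous {f : ℝ → ℝ} (hf : Continuous f) : Continuous (fun x => ee (f x)) :=
  ee_continuous.comp hf

/-- binning lemma -/
lemma bin_lemma {ι : Type*} [DecidableEq ι] (P : Finset ι) (z : ι → ℤ) (ω : ℤ → ℝ) (h0 : ∀ d, 0 ≤ ω d)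
    (W : ℝ) (hW : ∀ F : Finset ℤ, ∑ d ∈ F, ω d ≤ W) :
    ∑ p ∈ P ×ˢ P, ω (z p.1 - z p.2) ≤ W * ((P ×ˢ P).filter (fun p => z p.1 = z p.2)).card := by
  classical
  set I := P.image z
  set c : ℤ → ℝ := fun i => ((P.filter (fun p => z p = i)).card : ℝ) with hc
  have key : ∀ f : ℤ → ℝ, ∑ p ∈ P, f (z p) = ∑ i ∈ I, c i * f i := by
    intro f
    rw [Finset.sum_comp f z]
    simp [hc, I]
  have h1 : ∑ p ∈ P ×ˢ P, ω (z p.1 - z p.2) = ∑ i ∈ I, ∑ j ∈ I, c i * c j * ω (i - j) := by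
    rw [Finset.sum_product]
    rw [key (fun i => ∑ q ∈ P, ω (i - z q))]
    refine Finset.sum_congr rfl fun i _ => ?_
    rw [key (fun j => ω (i - j)), Finset.mul_sum]
    refine Finset.sum_congr rfl fun j _ => by ring
  have h2 : (((P ×ˢ P).filter (fun p => z p.1 = z p.2)).card : ℝ) = ∑ i ∈ I, c i * c i := by
    rw [Finset.card_filter]
    push_cast
    rw [Finset.sum_product]
    have := key (fun i => c i)
    rw [← this]
    refine Finset.sum_congr rfl fun p _ => ?_
    simp only [hc]
    rw [Finset.card_filter]
    push_cast
    refine Finset.sum_congr rfl fun q _ => ?_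
    simp only [eq_comm]
  have hrow : ∀ i, ∑ j ∈ I, ω (i - j) ≤ W := by
    intro i
    have := hW (I.image (fun j => i - j))
    rwa [Finset.sum_image (by intro a _ b _ h; simpa using h)] at this
  have hcol : ∀ j, ∑ i ∈ I, ω (i - j) ≤ W := by
    intro j
    have := hW (I.image (fun i => i - j))
    rwa [Finset.sum_image (by intro a _ b _ h; simpa using h)] at this
  rw [h1, h2]
  have h3 : ∑ i ∈ I, ∑ j ∈ I, c i * c j * ω (i - j)
      ≤ ∑ i ∈ I, ∑ j ∈ I, ((c i * c i) / 2 * ω (i - j) + (c j * c j) / 2 * ω (i - j)) := by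
    refine Finset.sum_le_sum fun i _ => Finset.sum_le_sum fun j _ => ?_
    nlinarith [h0 (i - j), mul_nonneg (sq_nonneg (c i - c j)) (h0 (i - j))]
  refine h3.trans ?_
  simp_rw [Finset.sum_add_distrib]
  rw [Finset.sum_comm (f := fun i j => (c j * c j) / 2 * ω (i - j))]
  simp_rw [← Finset.mul_sum]
  rw [← Finset.sum_add_distrib, Finset.mul_sum]
  refine Finset.sum_le_sum fun i _ => ?_
  have := hrow i
  have := hcol i
  have : 0 ≤ c i * c i := mul_self_nonneg _
  nlinarith

/-- binning with real values -/
lemma bin_real {ι : Type*} [DecidableEq ι] (P : Finset ι) (f : ι → ℝ) (γ : ℝ) (hγ : 0 < γ)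
    (ω : ℤ → ℝ) (h0 : ∀ d, 0 ≤ ω d)
    (W : ℝ) (hW : ∀ F : Finset ℤ, ∑ d ∈ F, ω d ≤ W) (g : ℝ → ℝ)
    (hg : ∀ x : ℝ, ∀ d : ℤ, |x / γ - d| ≤ 1 → g x ≤ ω d) :
    ∑ p ∈ P ×ˢ P, g (f p.1 - f p.2) ≤
      W * ((P ×ˢ P).filter (fun p => |f p.1 - f p.2| ≤ γ)).card := by
  have hW0 : 0 ≤ W := by simpa using hW ∅
  calc ∑ p ∈ P ×ˢ P, g (f p.1 - f p.2)
      ≤ ∑ p ∈ P ×ˢ P, ω (⌊f p.1 / γ⌋ - ⌊f p.2 / γ⌋) := by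
        refine Finset.sum_le_sum fun p _ => hg _ _ ?_
        push_cast
        rw [abs_le, sub_div]
        have h1 := Int.floor_le (f p.1 / γ)
        have h2 := Int.lt_floor_add_one (f p.1 / γ)
        have h3 := Int.floor_le (f p.2 / γ)
        have h4 := Int.lt_floor_add_one (f p.2 / γ)
        constructor <;> linarith
    _ ≤ W * ((P ×ˢ P).filter (fun p => ⌊f p.1 / γ⌋ = ⌊f p.2 / γ⌋)).card :=
        bin_lemma P (fun p => ⌊f p / γ⌋) ω h0 W hW
    _ ≤ _ := by
        gcongr with p hp
        intro h
        have h1 := Int.abs_sub_lt_one_of_floor_eq_floor h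
        rw [← sub_div, abs_div, abs_of_pos hγ, div_lt_one hγ] at h1
        exact h1.le


lemma summable_inv_one_add_sq : Summable (fun d : ℤ => 1 / (1 + (d : ℝ) ^ 2)) := by
  have h1 : Summable (fun d : ℤ => 1 / (d : ℝ) ^ 2) := Real.summable_one_div_int_pow.mpr (by norm_num)
  have h2 : Summable (fun d : ℤ => if d = 0 then (1 : ℝ) else 0) :=
    summable_of_ne_finset_zero (s := {0}) (by intro b hb; simp at hb; simp [hb])
  refine Summable.of_nonneg_of_le (fun d => by positivity) (fun d => ?_) (h1.add h2)
  by_cases hd : d = 0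
  · simp [hd]
  · simp only [hd, if_false, add_zero]
    have : (0 : ℝ) < (d : ℝ) ^ 2 := by positivity
    gcongr
    linarith

lemma gauss_re_neg (L : ℝ) (hL : 0 < L) : (-((π / L ^ 2 : ℝ) : ℂ)).re < 0 := by
  rw [Complex.neg_re, Complex.ofReal_re]
  have : 0 < π / L ^ 2 := by positivity
  linarith

lemma gauss_integral (L ξ : ℝ) (hL : 0 < L) :
    ‖∫ x : ℝ, Complex.exp ((-(π / L ^ 2 : ℝ) : ℂ) * x ^ 2 + ((2 * π * ξ : ℝ) * Complex.I) * x + 0)‖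
      = L * rexp (-π * (L * ξ) ^ 2) := by
  rw [integral_cexp_quadratic (gauss_re_neg L hL)]
  rw [norm_mul]
  congr 1
  · have : (π / - -((π / L ^ 2 : ℝ) : ℂ)) = ((L ^ 2 : ℝ) : ℂ) := by
      push_cast
      have : (π : ℂ) ≠ 0 := by exact_mod_cast pi_ne_zero
      have : (L : ℂ) ≠ 0 := by exact_mod_cast hL.ne'
      field_simp
    rw [this]
    rw [show (1 / 2 : ℂ) = ((1 / 2 : ℝ) : ℂ) by push_cast; rfl, ← Complex.ofReal_cpow (by positivity)]
    rw [Complex.norm_real, ← Real.sqrt_eq_rpow, Real.sqrt_sq hL.le, Real.norm_of_nonneg hL.le]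
  · rw [Complex.norm_exp]
    congr 1
    have : (0 - ((2 * π * ξ : ℝ) * Complex.I) ^ 2 / (4 * -((π / L ^ 2 : ℝ) : ℂ)))
        = ((-π * (L * ξ) ^ 2 : ℝ) : ℂ) := by
      rw [mul_pow, Complex.I_sq]
      push_cast
      have : (π : ℂ) ≠ 0 := by exact_mod_cast pi_ne_zero
      have : (L : ℂ) ≠ 0 := by exact_mod_cast hL.ne'
      field_simp
      ring
    rw [this, Complex.ofReal_re]

lemma normsq_sum {ι : Type*} (P : Finset ι) (b : ι → ℂ) (μ : ι → ℝ) (x : ℝ) :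
    ((‖∑ p ∈ P, b p * ee (x * μ p)‖ ^ 2 : ℝ) : ℂ) =
      ∑ p ∈ P ×ˢ P, b p.1 * (starRingEnd ℂ) (b p.2) * ee (x * (μ p.1 - μ p.2)) := by
  push_cast
  rw [← Complex.mul_conj', map_sum, Finset.sum_mul_sum, Finset.sum_product]
  refine Finset.sum_congr rfl fun p _ => Finset.sum_congr rfl fun q _ => ?_
  rw [map_mul, ee_conj, show x * (μ p - μ q) = x * μ p + -(x * μ q) by ring, ee_add]
  ring

noncomputable def C0 : ℝ := rexp π * ∑' d : ℤ, 3 * (1 / (1 + (d : ℝ) ^ 2))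

lemma C0_nonneg : 0 ≤ C0 := by
  unfold C0
  have : 0 ≤ ∑' d : ℤ, 3 * (1 / (1 + (d : ℝ) ^ 2)) := tsum_nonneg (fun d => by positivity)
  positivity

lemma gauss_int_integrable (L ξ : ℝ) (hL : 0 < L) : MeasureTheory.Integrable
    (fun x : ℝ => Complex.exp ((-(π / L ^ 2 : ℝ) : ℂ) * x ^ 2 + ((2 * π * ξ : ℝ) * Complex.I) * x + 0)) := by
  exact integrable_cexp_quadratic' (gauss_re_neg L hL) _ _

lemma gauss_L2 {ι : Type*} [DecidableEq ι] (P : Finset ι) (b : ι → ℂ) (hb : ∀ p, ‖b p‖ ≤ 1) (μ : ι → ℝ)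
    (L α β : ℝ) (hL : 0 < L) (hα : -L ≤ α) (hβ : β ≤ L) (hαβ : α ≤ β) :
    ∫ x in α..β, ‖∑ p ∈ P, b p * ee (x * μ p)‖ ^ 2
      ≤ C0 * L * ((P ×ˢ P).filter (fun p => |μ p.1 - μ p.2| ≤ 1 / L)).card := by
  set F : ℝ → ℝ := fun x => ‖∑ p ∈ P, b p * ee (x * μ p)‖ ^ 2 with hF
  have hFc : Continuous F := by
    rw [hF]
    refine (continuous_norm.comp ?_).pow 2
    refine continuous_finsetSum _ fun p _ => ?_
    exact continuous_const.mul (ee_comp_continuous (by fun_prop))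
  set G : ℝ → ℝ := fun x => rexp (-(π / L ^ 2) * x ^ 2) * F x with hG
  have hGeq : ∀ x, ((G x : ℝ) : ℂ) = ∑ p ∈ P ×ˢ P, b p.1 * (starRingEnd ℂ) (b p.2) *
      Complex.exp ((-(π / L ^ 2 : ℝ) : ℂ) * x ^ 2 + ((2 * π * (μ p.1 - μ p.2) : ℝ) * Complex.I) * x + 0) := by
    intro x
    rw [hG]
    dsimp only
    rw [Complex.ofReal_mul, hF]
    dsimp only
    rw [normsq_sum, Finset.mul_sum]
    refine Finset.sum_congr rfl fun p _ => ?_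
    rw [mul_left_comm]
    congr 1
    unfold ee
    rw [Complex.ofReal_exp, ← Complex.exp_add]
    congr 1
    push_cast; ring
  have hGi' : MeasureTheory.Integrable (fun x => ((G x : ℝ) : ℂ)) := by
    simp_rw [hGeq]
    refine MeasureTheory.integrable_finsetSum _ fun p _ => ?_
    exact (gauss_int_integrable L _ hL).const_mul _
  have hGi : MeasureTheory.Integrable G := by simpa using hGi'.re
  have hG0 : ∀ x, 0 ≤ G x := fun x => by rw [hG, hF]; positivity
  have hGint : ∫ x, G x ≤ L * ∑ p ∈ P ×ˢ P, rexp (-π * (L * (μ p.1 - μ p.2)) ^ 2) := by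
    have h1 : ((∫ x, G x : ℝ) : ℂ) = ∑ p ∈ P ×ˢ P, b p.1 * (starRingEnd ℂ) (b p.2) *
      ∫ x : ℝ, Complex.exp ((-(π / L ^ 2 : ℝ) : ℂ) * x ^ 2 + ((2 * π * (μ p.1 - μ p.2) : ℝ) * Complex.I) * x + 0) := by
      rw [← integral_complex_ofReal]
      simp_rw [hGeq]
      rw [MeasureTheory.integral_finsetSum]
      · refine Finset.sum_congr rfl fun p _ => ?_
        rw [MeasureTheory.integral_const_mul]
      · intro p _
        exact (gauss_int_integrable L _ hL).const_mul _
    have h2 : ∫ x, G x = ‖((∫ x, G x : ℝ) : ℂ)‖ := by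
      rw [Complex.norm_real, Real.norm_of_nonneg (MeasureTheory.integral_nonneg hG0)]
    rw [h2, h1, Finset.mul_sum]
    refine (norm_sum_le _ _).trans (Finset.sum_le_sum fun p _ => ?_)
    rw [norm_mul, gauss_integral _ _ hL, norm_mul, RCLike.norm_conj]
    have := mul_le_one₀ (hb p.1) (norm_nonneg _) (hb p.2)
    have h3 : 0 ≤ L * rexp (-π * (L * (μ p.1 - μ p.2)) ^ 2) := by positivity
    exact mul_le_of_le_one_left h3 this
  have hbin : ∑ p ∈ P ×ˢ P, rexp (-π * (L * (μ p.1 - μ p.2)) ^ 2) ≤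
      (∑' d : ℤ, 3 * (1 / (1 + (d : ℝ) ^ 2))) *
        ((P ×ˢ P).filter (fun p => |μ p.1 - μ p.2| ≤ 1 / L)).card := by
    refine bin_real P μ (1 / L) (by positivity) (fun d => 3 * (1 / (1 + (d : ℝ) ^ 2)))
      (fun d => by positivity) _ (fun F => ?_) (fun x => rexp (-π * (L * x) ^ 2)) ?_
    · exact (summable_inv_one_add_sq.mul_left 3).sum_le_tsum F (fun d _ => by positivity)
    · intro x d hd
      have e1 : x / (1 / L) = L * x := by field_simp
      rw [e1] at hd
      set y := L * x
      have h1 : rexp (-π * y ^ 2) ≤ 1 / (1 + y ^ 2) := by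
        rw [neg_mul, Real.exp_neg, ← one_div]
        have := Real.add_one_le_exp (π * y ^ 2)
        have := pi_gt_three
        gcongr
        nlinarith [sq_nonneg y]
      refine h1.trans ?_
      rw [mul_one_div, div_le_div_iff₀ (by positivity) (by positivity)]
      rw [abs_le] at hd
      nlinarith [sq_nonneg (y + (d : ℝ)), sq_nonneg (2 * y - d), sq_nonneg y]
  calc ∫ x in α..β, F x ≤ ∫ x in α..β, rexp π * G x := by
        refine intervalIntegral.integral_mono_on hαβ (hFc.intervalIntegrable _ _)
          ((Continuous.intervalIntegrable (by rw [hG]; fun_prop) _ _)) fun x hx => ?_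
        rw [hG]
        dsimp only
        rw [← mul_assoc, ← Real.exp_add]
        have hF0 : 0 ≤ F x := by rw [hF]; positivity
        refine le_mul_of_one_le_left hF0 ?_
        refine Real.one_le_exp ?_
        have hx2 : x ^ 2 ≤ L ^ 2 := by
          have := hx.1; have := hx.2
          nlinarith
        have : x ^ 2 / L ^ 2 ≤ 1 := by rw [div_le_one (by positivity)]; exact hx2
        have h4 : -(π / L ^ 2) * x ^ 2 = -(π * (x ^ 2 / L ^ 2)) := by ring
        rw [h4]
        nlinarith [pi_pos]
    _ = rexp π * ∫ x in α..β, G x := by rw [intervalIntegral.integral_const_mul]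
    _ ≤ rexp π * ∫ x, G x := by
        gcongr
        rw [intervalIntegral.integral_of_le hαβ]
        exact MeasureTheory.setIntegral_le_integral hGi (Filter.Eventually.of_forall hG0)
    _ ≤ rexp π * (L * ((∑' d : ℤ, 3 * (1 / (1 + (d : ℝ) ^ 2))) *
        ((P ×ˢ P).filter (fun p => |μ p.1 - μ p.2| ≤ 1 / L)).card)) := by
        gcongr
        exact hGint.trans (by gcongr)
    _ = _ := by unfold C0; ring


/-- lower bound: counting by a mean square -/
lemma fejer_lower {ι : Type*} [DecidableEq ι] (P P0 : Finset ι) (hP : P0 ⊆ P) (b : ι → ℝ)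
    (hb : ∀ p, 0 ≤ b p) (hb1 : ∀ p ∈ P0, 1 ≤ b p) (μ : ι → ℝ) (T : ℝ) (hT : 0 < T) :
    T * ((P0 ×ˢ P0).filter (fun p => |μ p.1 - μ p.2| ≤ 1 / (8 * T))).card ≤
      4 * ∫ x in (0:ℝ)..T, ‖∑ p ∈ P, (b p : ℂ) * ee (x * μ p)‖ ^ 2 := by
  set F : ℝ → ℝ := fun x => ‖∑ p ∈ P, (b p : ℂ) * ee (x * μ p)‖ ^ 2 with hF
  have hFc : Continuous F := by
    rw [hF]
    refine (continuous_norm.comp ?_).pow 2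
    refine continuous_finsetSum _ fun p _ => ?_
    exact continuous_const.mul (ee_comp_continuous (by fun_prop))
  have hF0 : ∀ x, 0 ≤ F x := fun x => by rw [hF]; positivity
  have hFe : ∀ x, F (-x) = F x := by
    intro x
    rw [hF]
    dsimp only
    congr 1
    rw [← RCLike.norm_conj, map_sum]
    congr 1
    refine Finset.sum_congr rfl fun p _ => ?_
    rw [map_mul, ee_conj, Complex.conj_ofReal]
    congr 2
    ring
  set E : ℝ → ℂ := fun ξ => ∫ u in (0:ℝ)..T, ee (u * ξ) with hE
  have hEn : ∀ ξ, |ξ| ≤ 1 / (8 * T) → T / 2 ≤ ‖E ξ‖ ^ 2 / T := by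
    intro ξ hξ
    have h1 : T * (√2 / 2) ≤ (E ξ).re := by
      have : (E ξ).re = ∫ u in (0:ℝ)..T, Real.cos (2 * π * (u * ξ)) := by
        rw [hE]
        dsimp only
        have := intervalIntegral.intervalIntegral_re (𝕜 := ℂ) (μ := MeasureTheory.volume) (f := fun u : ℝ => ee (u * ξ)) (a := 0) (b := T)
          (Continuous.intervalIntegrable (ee_comp_continuous (by fun_prop)) _ _)
        simp only [RCLike.re_eq_complex_re] at this
        rw [← this]
        congr 1
        ext u
        unfold ee
        rw [Complex.exp_ofReal_mul_I_re]
      rw [this]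
      have h2 : T * (√2 / 2) = ∫ u in (0:ℝ)..T, (√2 / 2) := by simp [mul_div_assoc]
      rw [h2]
      refine intervalIntegral.integral_mono_on hT.le (by simp) (Continuous.intervalIntegrable (by fun_prop) _ _) ?_
      intro u hu
      rw [← Real.cos_pi_div_four, ← Real.cos_abs (2 * π * (u * ξ))]
      have habs : |2 * π * (u * ξ)| ≤ π / 4 := by
        rw [abs_mul (2 * π), abs_mul u, abs_of_pos (by positivity : (0:ℝ) < 2 * π), abs_of_nonneg hu.1]
        have : u * |ξ| ≤ T * (1 / (8 * T)) := by
          have := hu.2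
          gcongr
        have h3 : T * (1 / (8 * T)) = 1 / 8 := by field_simp
        rw [h3] at this
        nlinarith [pi_pos]
      exact Real.cos_le_cos_of_nonneg_of_le_pi (abs_nonneg _) (by linarith [pi_pos]) habs
    have h2 : T * (√2 / 2) ≤ ‖E ξ‖ := h1.trans (Complex.re_le_norm _)
    have h3 : (T * (√2 / 2)) ^ 2 ≤ ‖E ξ‖ ^ 2 := by gcongr
    have h4 : (T * (√2 / 2)) ^ 2 = T ^ 2 / 2 := by
      have : √2 ^ 2 = 2 := Real.sq_sqrt (by norm_num)
      rw [mul_pow, div_pow, this]; ring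
    rw [le_div_iff₀ hT]
    nlinarith
  have hD : ∫ v in (0:ℝ)..T, ∫ u in (0:ℝ)..T, F (u - v) =
      ∑ p ∈ P ×ˢ P, b p.1 * b p.2 * ‖E (μ p.1 - μ p.2)‖ ^ 2 := by
    have hC : ((∫ v in (0:ℝ)..T, ∫ u in (0:ℝ)..T, F (u - v) : ℝ) : ℂ) =
      ∑ p ∈ P ×ˢ P, (b p.1 : ℂ) * b p.2 * (‖E (μ p.1 - μ p.2)‖ : ℂ) ^ 2 := by
      rw [← intervalIntegral.integral_ofReal]
      simp_rw [← intervalIntegral.integral_ofReal]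
      have h1 : ∀ v : ℝ, ∫ u in (0:ℝ)..T, ((F (u - v) : ℝ) : ℂ) =
          ∑ p ∈ P ×ˢ P, (b p.1 : ℂ) * b p.2 * E (μ p.1 - μ p.2) * ee (v * -(μ p.1 - μ p.2)) := by
        intro v
        rw [hF]
        dsimp only
        simp_rw [normsq_sum]
        rw [intervalIntegral.integral_finsetSum]
        · refine Finset.sum_congr rfl fun p _ => ?_
          rw [hE]
          dsimp only
          rw [mul_assoc, ← intervalIntegral.integral_mul_const, ← intervalIntegral.integral_const_mul]
          congr 1
          ext u
          rw [Complex.conj_ofReal, ← ee_add]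
          congr 2; ring
        · intro p _
          exact Continuous.intervalIntegrable
            (continuous_const.mul (ee_comp_continuous (by fun_prop))) _ _
      simp_rw [h1]
      rw [intervalIntegral.integral_finsetSum]
      · refine Finset.sum_congr rfl fun p _ => ?_
        rw [intervalIntegral.integral_const_mul, ← Complex.mul_conj', mul_assoc]
        congr 2
        rw [hE]
        dsimp only
        rw [intervalIntegral.integral_of_le hT.le, intervalIntegral.integral_of_le hT.le, ← integral_conj]
        congr 1
        ext u
        rw [ee_conj]; congr 1; ring
      · intro p _
        exact Continuous.intervalIntegrable
            (continuous_const.mul (ee_comp_continuous (by fun_prop))) _ _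
    exact_mod_cast hC
  have hU : ∫ v in (0:ℝ)..T, ∫ u in (0:ℝ)..T, F (u - v) ≤ T * (2 * ∫ x in (0:ℝ)..T, F x) := by
    have hin : ∀ v ∈ Set.Icc 0 T, ∫ u in (0:ℝ)..T, F (u - v) ≤ 2 * ∫ x in (0:ℝ)..T, F x := by
      intro v hv
      rw [intervalIntegral.integral_comp_sub_right (fun x => F x) v]
      have h1 : ∫ x in (0 - v)..(T - v), F x ≤ ∫ x in (-T)..T, F x := by
        refine intervalIntegral.integral_mono_interval (by linarith [hv.2]) (by linarith)
          (by linarith [hv.1]) (Filter.Eventually.of_forall hF0) (hFc.intervalIntegrable _ _)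
      have h2 : ∫ x in (-T)..T, F x = (∫ x in (-T)..0, F x) + ∫ x in (0:ℝ)..T, F x :=
        (intervalIntegral.integral_add_adjacent_intervals (hFc.intervalIntegrable _ _)
          (hFc.intervalIntegrable _ _)).symm
      have h3 : ∫ x in (-T)..0, F x = ∫ x in (0:ℝ)..T, F x := by
        have := intervalIntegral.integral_comp_neg (a := 0) (b := T) F
        rw [neg_zero] at this
        rw [← this]
        simp_rw [hFe]
      linarith
    have h4 : T * (2 * ∫ x in (0:ℝ)..T, F x) = ∫ v in (0:ℝ)..T, (2 * ∫ x in (0:ℝ)..T, F x) := by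
      rw [intervalIntegral.integral_const, smul_eq_mul, sub_zero]
    rw [h4]
    refine intervalIntegral.integral_mono_on hT.le ?_ (by simp) hin
    refine Continuous.intervalIntegrable ?_ _ _
    exact intervalIntegral.continuous_parametric_intervalIntegral_of_continuous' (by fun_prop) _ _
  have hL : ((P0 ×ˢ P0).filter (fun p => |μ p.1 - μ p.2| ≤ 1 / (8 * T))).card * (T / 2 * T) ≤
      ∑ p ∈ P ×ˢ P, b p.1 * b p.2 * ‖E (μ p.1 - μ p.2)‖ ^ 2 := by
    calc _ = ∑ p ∈ (P0 ×ˢ P0).filter (fun p => |μ p.1 - μ p.2| ≤ 1 / (8 * T)), (T / 2 * T) := by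
          rw [Finset.sum_const, nsmul_eq_mul]
      _ ≤ ∑ p ∈ (P0 ×ˢ P0).filter (fun p => |μ p.1 - μ p.2| ≤ 1 / (8 * T)),
          b p.1 * b p.2 * ‖E (μ p.1 - μ p.2)‖ ^ 2 := by
          refine Finset.sum_le_sum fun p hp => ?_
          rw [Finset.mem_filter, Finset.mem_product] at hp
          have h1 := hEn _ hp.2
          rw [le_div_iff₀ hT] at h1
          have h2 : 1 ≤ b p.1 * b p.2 := one_le_mul_of_one_le_of_one_le (hb1 _ hp.1.1) (hb1 _ hp.1.2)
          exact h1.trans (le_mul_of_one_le_left (by positivity) h2)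
      _ ≤ _ := by
          refine Finset.sum_le_sum_of_subset_of_nonneg ?_ fun p _ _ => ?_
          · intro p hp
            rw [Finset.mem_filter, Finset.mem_product] at hp
            exact Finset.mem_product.mpr ⟨hP hp.1.1, hP hp.1.2⟩
          · have := hb p.1; have := hb p.2; positivity
  rw [← hD] at hL
  have := hL.trans hU
  nlinarith

/-- the counting function -/
noncomputable def cnt (s : Finset ℕ) (ν : ℕ → ℝ) (γ : ℝ) : ℕ :=
  (((s ×ˢ s) ×ˢ (s ×ˢ s)).filter
    (fun p => |(ν p.1.1 + ν p.1.2) - (ν p.2.1 + ν p.2.2)| ≤ γ)).card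

lemma sq_sum_ee (s : Finset ℕ) (b : ℕ → ℂ) (ν : ℕ → ℝ) (x : ℝ) :
    (∑ n ∈ s, b n * ee (x * ν n)) ^ 2 =
      ∑ p ∈ s ×ˢ s, (b p.1 * b p.2) * ee (x * (ν p.1 + ν p.2)) := by
  rw [sq, Finset.sum_mul_sum, Finset.sum_product]
  refine Finset.sum_congr rfl fun p _ => Finset.sum_congr rfl fun q _ => ?_
  rw [mul_add, ee_add]; ring

lemma fourth_upper (s : Finset ℕ) (b : ℕ → ℂ) (hb : ∀ p, ‖b p‖ ≤ 1) (ν : ℕ → ℝ)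
    (L α β : ℝ) (hL : 0 < L) (hα : -L ≤ α) (hβ : β ≤ L) (hαβ : α ≤ β) :
    ∫ x in α..β, ‖∑ n ∈ s, b n * ee (x * ν n)‖ ^ 4 ≤ C0 * L * cnt s ν (1 / L) := by
  have := gauss_L2 (s ×ˢ s) (fun p => b p.1 * b p.2)
    (fun p => by rw [norm_mul]; exact mul_le_one₀ (hb _) (norm_nonneg _) (hb _))
    (fun p => ν p.1 + ν p.2) L α β hL hα hβ hαβ
  simp_rw [← sq_sum_ee, norm_pow, ← pow_mul] at this
  exact this

lemma fourth_lower (s s0 : Finset ℕ) (hs : s0 ⊆ s) (b : ℕ → ℝ) (hb : ∀ p, 0 ≤ b p)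
    (hb1 : ∀ p ∈ s0, 1 ≤ b p) (ν : ℕ → ℝ) (T : ℝ) (hT : 0 < T) :
    T * cnt s0 ν (1 / (8 * T)) ≤ 4 * ∫ x in (0:ℝ)..T, ‖∑ n ∈ s, (b n : ℂ) * ee (x * ν n)‖ ^ 4 := by
  have := fejer_lower (s ×ˢ s) (s0 ×ˢ s0) (Finset.product_subset_product hs hs)
    (fun p => b p.1 * b p.2) (fun p => mul_nonneg (hb _) (hb _))
    (fun p hp => one_le_mul_of_one_le_of_one_le (hb1 _ (Finset.mem_product.mp hp).1)
      (hb1 _ (Finset.mem_product.mp hp).2))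
    (fun p => ν p.1 + ν p.2) T hT
  simp only [Complex.ofReal_mul] at this
  simp_rw [← sq_sum_ee s (fun n => (b n : ℂ)), norm_pow, ← pow_mul] at this
  exact this

lemma cnt_mono {s s' : Finset ℕ} (hs : s ⊆ s') (ν : ℕ → ℝ) {γ γ' : ℝ} (h : γ ≤ γ') :
    cnt s ν γ ≤ cnt s' ν γ' := by
  unfold cnt
  refine Finset.card_le_card fun p hp => ?_
  simp only [Finset.mem_filter, Finset.mem_product] at hp ⊢
  exact ⟨⟨⟨hs hp.1.1.1, hs hp.1.1.2⟩, ⟨hs hp.1.2.1, hs hp.1.2.2⟩⟩, hp.2.trans h⟩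

lemma cnt_scale (s : Finset ℕ) (ν : ℕ → ℝ) (γ c : ℝ) (hc : 0 < c) :
    cnt s (fun n => ν n * c) (γ * c) = cnt s ν γ := by
  unfold cnt
  congr 1
  refine Finset.filter_congr fun p _ => ?_
  rw [show ν p.1.1 * c + ν p.1.2 * c - (ν p.2.1 * c + ν p.2.2 * c)
    = ((ν p.1.1 + ν p.1.2) - (ν p.2.1 + ν p.2.2)) * c by ring, abs_mul, abs_of_pos hc]
  exact mul_le_mul_iff_left₀ hc

/-- enlarging the tolerance -/
lemma cnt_enlarge (s : Finset ℕ) (ν : ℕ → ℝ) (γ l : ℝ) (hγ : 0 < γ) (hl : 0 ≤ l) :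
    (cnt s ν (l * γ) : ℝ) ≤ (2 * l + 5) * cnt s ν γ := by
  classical
  have := bin_real (s ×ˢ s) (fun p => ν p.1 + ν p.2) γ hγ
    (fun d => if |(d : ℝ)| ≤ l + 1 then 1 else 0) (fun d => by split_ifs <;> norm_num)
    (2 * l + 5) ?_ (fun x => if |x| ≤ l * γ then 1 else 0) ?_
  · rw [Finset.sum_boole] at this
    exact this
  · intro F
    rw [Finset.sum_ite, Finset.sum_const_zero, add_zero, Finset.sum_const, nsmul_eq_mul, mul_one]
    have h1 : F.filter (fun d : ℤ => |(d : ℝ)| ≤ l + 1) ⊆ Finset.Icc (-⌊l + 1⌋) ⌊l + 1⌋ := by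
      intro d hd
      rw [Finset.mem_filter, abs_le] at hd
      rw [Finset.mem_Icc]
      have h2 : d ≤ ⌊l + 1⌋ := Int.le_floor.mpr hd.2.2
      have h3 : -d ≤ ⌊l + 1⌋ := Int.le_floor.mpr (by push_cast; linarith [hd.2.1])
      omega
    have h2 := Finset.card_le_card h1
    rw [Int.card_Icc] at h2
    have h4 : 0 ≤ ⌊l + 1⌋ := Int.floor_nonneg.mpr (by linarith)
    have h3 : ((⌊l + 1⌋ + 1 - -⌊l + 1⌋).toNat : ℝ) ≤ 2 * l + 5 := by
      have h5 : (((⌊l + 1⌋ + 1 - -⌊l + 1⌋).toNat : ℤ) : ℝ) = ((⌊l + 1⌋ + 1 - -⌊l + 1⌋ : ℤ) : ℝ) := by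
        rw [Int.toNat_of_nonneg (by omega)]
      have h6 : (((⌊l + 1⌋ + 1 - -⌊l + 1⌋).toNat : ℤ) : ℝ) = ((⌊l + 1⌋ + 1 - -⌊l + 1⌋).toNat : ℝ) := by
        norm_cast
      rw [← h6, h5]
      push_cast
      have := Int.floor_le (l + 1)
      linarith
    exact le_trans (by exact_mod_cast h2) h3
  · intro x d hd
    by_cases h : |x| ≤ l * γ
    · have h1 : |(d : ℝ)| ≤ l + 1 := by
        have h2 : |x / γ| ≤ l := by
          rw [abs_div, abs_of_pos hγ, div_le_iff₀ hγ]; exact h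
        have h3 : |(d : ℝ)| ≤ |x / γ| + |x / γ - d| := by
          have := abs_sub_abs_le_abs_sub (d : ℝ) (x / γ)
          rw [abs_sub_comm] at this
          linarith
        linarith
      rw [if_pos h, if_pos h1]
    · rw [if_neg h]; split_ifs <;> norm_num


lemma ee_hasDerivAt {f : ℝ → ℝ} {f' x : ℝ} (hf : HasDerivAt f f' x) :
    HasDerivAt (fun y => ee (f y)) (((2 * π * f' : ℝ) : ℂ) * Complex.I * ee (f x)) x := by
  unfold ee
  have h1 : HasDerivAt (fun y => 2 * π * f y) (2 * π * f') x := hf.const_mul _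
  have h2 := (h1.ofReal_comp.mul_const Complex.I).cexp
  convert h2 using 1
  ring

lemma integral_lorentz (y1 y2 μ : ℝ) (h : y1 ≤ y2) (hμ : 0 < μ) :
    ∫ y in y1..y2, 1 / (1 + μ ^ 2 * (y - 1) ^ 2) ≤ π / μ := by
  have h1 : ∫ y in y1..y2, 1 / (1 + μ ^ 2 * (y - 1) ^ 2)
      = ∫ y in y1..y2, (fun u => 1 / (1 + u ^ 2)) (μ * y - μ) := by
    congr 1; ext y; congr 2; ring
  rw [h1, intervalIntegral.integral_comp_mul_sub (fun u : ℝ => 1 / (1 + u ^ 2)) hμ.ne', integral_one_div_one_add_sq]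
  have a1 := Real.arctan_lt_pi_div_two (μ * y2 - μ)
  have a2 := Real.neg_pi_div_two_lt_arctan (μ * y1 - μ)
  rw [smul_eq_mul, div_eq_inv_mul]
  have : 0 < μ⁻¹ := inv_pos.mpr hμ
  apply mul_le_mul_of_nonneg_left _ this.le
  linarith

lemma vdc_abs (q q' q'' : ℝ → ℝ) (y1 y2 c C : ℝ) (hy : y1 ≤ y2) (hc : 0 < c) (hC : 0 ≤ C)
    (hq : ∀ y ∈ Set.Icc y1 y2, HasDerivAt q (q' y) y)
    (hq' : ∀ y ∈ Set.Icc y1 y2, HasDerivAt q' (q'' y) y)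
    (hq'' : ContinuousOn q'' (Set.Icc y1 y2))
    (hlow : ∀ y ∈ Set.Icc y1 y2, c * (y - 1) ^ 2 ≤ (y - 1) * q' y)
    (hup : ∀ y ∈ Set.Icc y1 y2, |q' y| ≤ C * |y - 1|)
    (hup2 : ∀ y ∈ Set.Icc y1 y2, |q'' y| ≤ C)
    (lam D : ℝ) (hlam : 0 < lam) (hD : 0 ≤ D) (G G' : ℝ → ℂ)
    (hG : ∀ y ∈ Set.Icc y1 y2, HasDerivAt G (G' y) y)
    (hG' : ContinuousOn G' (Set.Icc y1 y2)) (hG1 : G y1 = 0) (hG2 : G y2 = 0)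
    (hGD : ∀ y ∈ Set.Icc y1 y2, ‖G y‖ ≤ D) (hGD' : ∀ y ∈ Set.Icc y1 y2, ‖G' y‖ ≤ D) :
    ‖∫ y in y1..y2, G y * ee (lam * q y)‖
      ≤ ((y2 - y1) / √c + 16 * π ^ 2 * C / (c * √c)) * D / √lam := by
  have hIcc : Set.uIcc y1 y2 = Set.Icc y1 y2 := Set.uIcc_of_le hy
  set Q : ℝ → ℂ := fun y => 1 + ((2 * π * (lam * ((y - 1) * q' y)) : ℝ) : ℂ) * Complex.I with hQ
  set Q' : ℝ → ℂ := fun y => ((2 * π * (lam * (1 * q' y + (y - 1) * q'' y)) : ℝ) : ℂ) * Complex.I with hQ'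
  have hQd : ∀ y ∈ Set.Icc y1 y2, HasDerivAt Q (Q' y) y := by
    intro y hy
    have h1 : HasDerivAt (fun y => (y - 1) * q' y) (1 * q' y + (y - 1) * q'' y) y :=
      ((hasDerivAt_id y).sub_const 1).mul (hq' y hy)
    have h2 := (((h1.const_mul lam).const_mul (2 * π)).ofReal_comp.mul_const Complex.I).const_add 1
    exact h2
  have hQre : ∀ y, (Q y).re = 1 := by intro y; simp [hQ]
  have hQim : ∀ y, (Q y).im = 2 * π * (lam * ((y - 1) * q' y)) := by intro y; simp [hQ]
  have hQ1 : ∀ y, 1 ≤ ‖Q y‖ := by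
    intro y
    have := Complex.abs_re_le_norm (Q y)
    rw [hQre, abs_one] at this; exact this
  have hQ0 : ∀ y, Q y ≠ 0 := by
    intro y h; have := hQ1 y; rw [h, norm_zero] at this; linarith
  have hQlow : ∀ y ∈ Set.Icc y1 y2, 1 + lam * c * (y - 1) ^ 2 ≤ 2 * ‖Q y‖ := by
    intro y hy
    have h1 := hQ1 y
    have h2 := Complex.abs_im_le_norm (Q y)
    rw [hQim] at h2
    have h3 := le_abs_self (2 * π * (lam * ((y - 1) * q' y)))
    have h4 := hlow y hy
    have h5 : lam * (c * (y - 1) ^ 2) ≤ lam * ((y - 1) * q' y) := by gcongr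
    have h6 : 0 ≤ lam * (c * (y - 1) ^ 2) := by positivity
    have h7 := Real.pi_gt_three
    nlinarith
  have hQ'up : ∀ y ∈ Set.Icc y1 y2, ‖Q' y‖ ≤ 4 * π * C * lam * |y - 1| := by
    intro y hy
    simp only [hQ', norm_mul, Complex.norm_I, mul_one, Complex.norm_real, Real.norm_eq_abs]
    have h1 : |1 * q' y + (y - 1) * q'' y| ≤ 2 * C * |y - 1| := by
      calc _ ≤ |1 * q' y| + |(y - 1) * q'' y| := abs_add_le _ _
        _ ≤ C * |y - 1| + |y - 1| * C := by
            rw [one_mul, abs_mul]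
            have := hup y hy
            have := hup2 y hy
            gcongr
        _ = _ := by ring
    rw [abs_of_pos hlam, abs_of_pos Real.pi_pos, abs_of_pos (zero_lt_two' ℝ)]
    calc 2 * π * (lam * |1 * q' y + (y - 1) * q'' y|) ≤ 2 * π * (lam * (2 * C * |y - 1|)) := by gcongr
      _ = _ := by ring
  have hqc : ContinuousOn q (Set.Icc y1 y2) := fun y hy => (hq y hy).continuousAt.continuousWithinAt
  have hq'c : ContinuousOn q' (Set.Icc y1 y2) := fun y hy => (hq' y hy).continuousAt.continuousWithinAt
  have hGc : ContinuousOn G (Set.Icc y1 y2) := fun y hy => (hG y hy).continuousAt.continuousWithinAt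
  have hQc : ContinuousOn Q (Set.Icc y1 y2) := fun y hy => (hQd y hy).continuousAt.continuousWithinAt
  have hQ'c : ContinuousOn Q' (Set.Icc y1 y2) := by
    simp only [hQ']
    refine ContinuousOn.mul ?_ continuousOn_const
    refine Complex.continuous_ofReal.comp_continuousOn ?_
    fun_prop
  have hec : ContinuousOn (fun y => ee (lam * q y)) (Set.Icc y1 y2) :=
    ee_continuous.comp_continuousOn (by fun_prop)
  have hparts := intervalIntegral.integral_mul_deriv_eq_deriv_mul (a := y1) (b := y2)
    (u := fun y => G y / Q y) (u' := fun y => (G' y * Q y - G y * Q' y) / (Q y) ^ 2)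
    (v := fun y => ((y - 1 : ℝ) : ℂ) * ee (lam * q y)) (v' := fun y => Q y * ee (lam * q y))
    (by
      rw [hIcc]; intro y hy
      exact (hG y hy).div (hQd y hy) (hQ0 y))
    (by
      rw [hIcc]; intro y hy
      have h1 := (((hasDerivAt_id' y).sub_const 1).ofReal_comp).mul
        (ee_hasDerivAt ((hq y hy).const_mul lam))
      refine HasDerivAt.congr_deriv (f := fun y : ℝ => ((y - 1 : ℝ) : ℂ) * ee (lam * q y)) h1 ?_
      simp only [hQ]
      push_cast
      ring)
    (by
      apply ContinuousOn.intervalIntegrable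
      rw [hIcc]
      exact ((hG'.mul hQc).sub (hGc.mul hQ'c)).div (hQc.pow 2) (fun y _ => pow_ne_zero 2 (hQ0 y)))
    (by
      apply ContinuousOn.intervalIntegrable
      rw [hIcc]
      exact hQc.mul hec)
  have hL : ∫ y in y1..y2, G y / Q y * (Q y * ee (lam * q y)) = ∫ y in y1..y2, G y * ee (lam * q y) := by
    congr 1; ext y; field_simp [hQ0 y]
  simp only [hG1, hG2, zero_div, zero_mul, sub_zero, zero_sub, hL] at hparts
  rw [hparts, norm_neg]
  set X : ℝ → ℝ := fun y => lam * c * (y - 1) ^ 2 with hX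
  have hlc : 0 < lam * c := by positivity
  set μ := √(lam * c) with hμ
  have hμpos : 0 < μ := Real.sqrt_pos.mpr hlc
  have hμ2 : μ ^ 2 = lam * c := Real.sq_sqrt hlc.le
  have hbound : ∀ y ∈ Set.Icc y1 y2,
      ‖(G' y * Q y - G y * Q' y) / (Q y) ^ 2 * (((y - 1 : ℝ) : ℂ) * ee (lam * q y))‖
       ≤ D / μ + 16 * π * C / c * D * (1 / (1 + μ ^ 2 * (y - 1) ^ 2)) := by
    intro y hy
    rw [norm_mul, norm_mul, ee_norm, mul_one, Complex.norm_real, Real.norm_eq_abs, norm_div, norm_pow]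
    have hq0 : 0 < ‖Q y‖ := lt_of_lt_of_le one_pos (hQ1 y)
    have hn : ‖G' y * Q y - G y * Q' y‖ ≤ D * ‖Q y‖ + D * (4 * π * C * lam * |y - 1|) := by
      refine (norm_sub_le _ _).trans ?_
      rw [norm_mul, norm_mul]
      have := hGD y hy
      have := hGD' y hy
      have := hQ'up y hy
      gcongr
    have hl := hQlow y hy
    have habs : |y - 1| ^ 2 = (y - 1) ^ 2 := sq_abs _
    set a := |y - 1| with ha
    have ha0 : 0 ≤ a := abs_nonneg _
    rw [← habs] at hl ⊢
    rw [← hμ2] at hl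
    have hW : 0 < 1 + μ ^ 2 * a ^ 2 := by positivity
    have e1 : D * ‖Q y‖ * a / ‖Q y‖ ^ 2 ≤ D / μ := by
      rw [div_le_div_iff₀ (by positivity) hμpos]
      have : a * μ ≤ ‖Q y‖ := by nlinarith [sq_nonneg (μ * a - 1)]
      calc D * ‖Q y‖ * a * μ = D * ‖Q y‖ * (a * μ) := by ring
        _ ≤ D * ‖Q y‖ * ‖Q y‖ := by gcongr
        _ = _ := by ring
    have e2 : D * (4 * π * C * lam * a) * a / ‖Q y‖ ^ 2 ≤ 16 * π * C / c * D * (1 / (1 + μ ^ 2 * a ^ 2)) := by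
      have h1 : 16 * π * C / c * D * (1 / (1 + μ ^ 2 * a ^ 2))
          = (16 * π * C * D) / (c * (1 + μ ^ 2 * a ^ 2)) := by field_simp
      rw [h1, div_le_div_iff₀ (by positivity) (by positivity)]
      have h2 : lam * a ^ 2 * (c * (1 + μ ^ 2 * a ^ 2)) ≤ 4 * ‖Q y‖ ^ 2 := by
        have : lam * a ^ 2 * (c * (1 + μ ^ 2 * a ^ 2)) = (μ ^ 2 * a ^ 2) * (1 + μ ^ 2 * a ^ 2) := by
          rw [hμ2]; ring
        rw [this]; nlinarith [sq_nonneg (μ * a)]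
      calc D * (4 * π * C * lam * a) * a * (c * (1 + μ ^ 2 * a ^ 2))
          = (4 * π * C * D) * (lam * a ^ 2 * (c * (1 + μ ^ 2 * a ^ 2))) := by ring
        _ ≤ (4 * π * C * D) * (4 * ‖Q y‖ ^ 2) := by gcongr
        _ = _ := by ring
    calc ‖G' y * Q y - G y * Q' y‖ / ‖Q y‖ ^ 2 * a
        ≤ (D * ‖Q y‖ + D * (4 * π * C * lam * a)) / ‖Q y‖ ^ 2 * a := by gcongr
      _ = D * ‖Q y‖ * a / ‖Q y‖ ^ 2 + D * (4 * π * C * lam * a) * a / ‖Q y‖ ^ 2 := by ring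
      _ ≤ _ := add_le_add e1 e2
  have hcl : Continuous (fun y : ℝ => 1 / (1 + μ ^ 2 * (y - 1) ^ 2)) := by
    refine Continuous.div continuous_const (by fun_prop) ?_
    intro y; positivity
  calc _ ≤ ∫ y in y1..y2, (D / μ + 16 * π * C / c * D * (1 / (1 + μ ^ 2 * (y - 1) ^ 2))) := by
        apply intervalIntegral.norm_integral_le_of_norm_le hy
        · filter_upwards with y hy'
          exact hbound y ⟨hy'.1.le, hy'.2⟩
        · apply Continuous.intervalIntegrable
          fun_prop
    _ = (y2 - y1) * (D / μ) + 16 * π * C / c * D * ∫ y in y1..y2, 1 / (1 + μ ^ 2 * (y - 1) ^ 2) := by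
        rw [intervalIntegral.integral_add (by simp) ((hcl.const_mul _).intervalIntegrable _ _)]
        rw [intervalIntegral.integral_const, intervalIntegral.integral_const_mul, smul_eq_mul]
    _ ≤ (y2 - y1) * (D / μ) + 16 * π * C / c * D * (π / μ) := by
        have := integral_lorentz y1 y2 μ hy hμpos
        gcongr
    _ = _ := by
        rw [hμ, Real.sqrt_mul hlam.le]
        have : 0 < √lam := Real.sqrt_pos.mpr hlam
        have : 0 < √c := Real.sqrt_pos.mpr hc
        field_simp


noncomputable def qq (k y : ℝ) : ℝ := y ^ k - k * y + (k - 1)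
noncomputable def qd (k y : ℝ) : ℝ := k * (y ^ (k - 1) - 1)
noncomputable def qdd (k y : ℝ) : ℝ := k * ((k - 1) * y ^ (k - 2))

lemma qq_deriv (k y : ℝ) (hy : 0 < y) : HasDerivAt (qq k) (qd k y) y := by
  have h1 := ((Real.hasDerivAt_rpow_const (x := y) (p := k) (Or.inl hy.ne')).sub
    ((hasDerivAt_id y).const_mul k)).add_const (k - 1)
  refine HasDerivAt.congr_deriv (f := qq k) h1 ?_
  unfold qd
  ring

lemma qd_deriv (k y : ℝ) (hy : 0 < y) : HasDerivAt (qd k) (qdd k y) y := by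
  have h1 := ((Real.hasDerivAt_rpow_const (x := y) (p := k - 1) (Or.inl hy.ne')).sub_const 1).const_mul k
  refine HasDerivAt.congr_deriv (f := qd k) h1 ?_
  unfold qdd
  rw [show k - 1 - 1 = k - 2 by ring]

lemma rpow_analytic (r y : ℝ) (hy : 0 < y) : AnalyticAt ℝ (fun x : ℝ => x ^ r) y :=
  ContDiffAt.analyticAt (Real.contDiffAt_rpow_const_of_ne hy.ne')

lemma qq_analytic (k : ℝ) : ∀ y > 0, AnalyticAt ℝ (qq k) y := by
  intro y hy
  have := rpow_analytic k y hy
  unfold qq; fun_prop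

lemma qd_analytic (k : ℝ) : ∀ y > 0, AnalyticAt ℝ (qd k) y := by
  intro y hy
  have := rpow_analytic (k - 1) y hy
  unfold qd; fun_prop

lemma dslope_analytic (f : ℝ → ℝ) (hf : ∀ y > 0, AnalyticAt ℝ f y) :
    ∀ y > 0, AnalyticAt ℝ (dslope f 1) y := by
  intro y hy
  by_cases h : y = 1
  · subst h
    obtain ⟨p, hp⟩ := hf 1 hy
    exact ⟨_, hp.has_fpower_series_dslope_fslope⟩
  · have h1 : dslope f 1 =ᶠ[nhds y] slope f 1 := dslope_eventuallyEq_slope_of_ne f h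
    refine AnalyticAt.congr ?_ h1.symm
    have h2 : slope f 1 = fun x => (x - 1)⁻¹ * (f x - f 1) := by
      ext x; simp [slope]
    rw [h2]
    have := hf y hy
    refine AnalyticAt.mul (AnalyticAt.inv (by fun_prop) (sub_ne_zero.mpr h)) (by fun_prop)

lemma dslope_mul (f : ℝ → ℝ) (hf : f 1 = 0) (y : ℝ) : (y - 1) * dslope f 1 y = f y := by
  have := sub_smul_dslope f 1 y
  simpa [hf] using this

lemma qd_one (k : ℝ) : qd k 1 = 0 := by simp [qd]
lemma qq_one (k : ℝ) : qq k 1 = 0 := by simp [qq]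

lemma qb_pos (k : ℝ) (hk : 1 < k) (y : ℝ) (hy : 0 < y) : 0 < dslope (qd k) 1 y := by
  rcases lt_trichotomy y 1 with h | h | h
  · have h1 := dslope_mul (qd k) (qd_one k) y
    have h2 : qd k y < 0 := by
      unfold qd
      have : y ^ (k - 1) < 1 := Real.rpow_lt_one hy.le h (by linarith)
      nlinarith
    by_contra! h3
    nlinarith
  · subst h
    rw [dslope_same, (qd_deriv k 1 one_pos).deriv]
    unfold qdd
    rw [Real.one_rpow]
    nlinarith
  · have h1 := dslope_mul (qd k) (qd_one k) y
    have h2 : 0 < qd k y := by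
      unfold qd
      have : 1 < y ^ (k - 1) := Real.one_lt_rpow h (by linarith)
      nlinarith
    by_contra! h3
    nlinarith

lemma phase_facts (k : ℝ) (hk : 1 < k) (y1 y2 : ℝ) (hy1 : 0 < y1) (hy : y1 ≤ y2) :
    ∃ c > 0, ∃ C ≥ 0, (∀ y ∈ Set.Icc y1 y2, c * (y - 1) ^ 2 ≤ (y - 1) * qd k y) ∧
    (∀ y ∈ Set.Icc y1 y2, |qd k y| ≤ C * |y - 1|) ∧ (∀ y ∈ Set.Icc y1 y2, |qdd k y| ≤ C) ∧
    ContinuousOn (qdd k) (Set.Icc y1 y2) := by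
  have hb : ContinuousOn (dslope (qd k) 1) (Set.Icc y1 y2) := fun y h =>
    (dslope_analytic _ (qd_analytic k) y (hy1.trans_le h.1)).continuousAt.continuousWithinAt
  have hdd : ContinuousOn (qdd k) (Set.Icc y1 y2) := by
    intro y h
    have h0 : y ≠ 0 := (hy1.trans_le h.1).ne'
    unfold qdd
    refine ContinuousAt.continuousWithinAt ?_
    have := Real.continuousAt_rpow_const y (k - 2) (Or.inl h0)
    fun_prop
  obtain ⟨ym, hym, hmin⟩ := isCompact_Icc.exists_isMinOn (Set.nonempty_Icc.mpr hy) hb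
  obtain ⟨C1, hC1⟩ := isCompact_Icc.exists_bound_of_continuousOn hb
  obtain ⟨C2, hC2⟩ := isCompact_Icc.exists_bound_of_continuousOn hdd
  refine ⟨dslope (qd k) 1 ym, qb_pos k hk _ (hy1.trans_le hym.1), max (max C1 C2) 0, le_max_right _ _, ?_, ?_, ?_, hdd⟩
  · intro y h
    rw [← dslope_mul (qd k) (qd_one k) y]
    have := hmin h
    simp only [Set.mem_setOf_eq] at this
    nlinarith [sq_nonneg (y - 1)]
  · intro y h
    rw [← dslope_mul (qd k) (qd_one k) y, abs_mul, mul_comm]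
    have := hC1 y h
    rw [Real.norm_eq_abs] at this
    gcongr
    exact this.trans ((le_max_left _ _).trans (le_max_left _ _))
  · intro y h
    exact (hC2 y h).trans ((le_max_right _ _).trans (le_max_left _ _))

lemma rho_exists (k : ℝ) (hk : 1 < k) : ∃ r : ℝ → ℝ, (∀ y > 0, AnalyticAt ℝ r y) ∧
    ∀ y > 0, r y * qd k y = qq k y := by
  refine ⟨fun y => (y - 1) * dslope (dslope (qq k) 1) 1 y / dslope (qd k) 1 y, ?_, ?_⟩
  · intro y hy
    have h1 := dslope_analytic _ (dslope_analytic _ (qq_analytic k)) y hy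
    have h2 := dslope_analytic _ (qd_analytic k) y hy
    refine AnalyticAt.div (by fun_prop) h2 (qb_pos k hk y hy).ne'
  · intro y hy
    have h1 := dslope_mul (qq k) (qq_one k) y
    have h2 : dslope (qq k) 1 1 = 0 := by
      rw [dslope_same, (qq_deriv k 1 one_pos).deriv, qd_one]
    have h3 := dslope_mul (dslope (qq k) 1) h2 y
    have h4 := dslope_mul (qd k) (qd_one k) y
    have h5 := (qb_pos k hk y hy).ne'
    rw [← h1, ← h3, ← h4]
    field_simp

/-- van der Corput test for the phase `qq`. -/
lemma vdc (k : ℝ) (hk : 1 < k) (y1 y2 : ℝ) (hy1 : 0 < y1) (hy : y1 ≤ y2) :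
    ∃ C ≥ 0, ∀ (lam D : ℝ), 0 < lam → 0 ≤ D → ∀ (G G' : ℝ → ℂ),
    (∀ y ∈ Set.Icc y1 y2, HasDerivAt G (G' y) y) → 
    ContinuousOn G' (Set.Icc y1 y2) → G y1 = 0 → G y2 = 0 → 
    (∀ y ∈ Set.Icc y1 y2, ‖G y‖ ≤ D) → (∀ y ∈ Set.Icc y1 y2, ‖G' y‖ ≤ D) → 
    ‖∫ y in y1..y2, G y * ee (lam * qq k y)‖ ≤ C * D / √lam := by
  obtain ⟨c, hc, C, hC, h1, h2, h3, h4⟩ := phase_facts k hk y1 y2 hy1 hy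
  refine ⟨(y2 - y1) / √c + 16 * π ^ 2 * C / (c * √c), ?_, ?_⟩
  · have : 0 ≤ y2 - y1 := by linarith
    positivity
  · intro lam D hlam hD G G' g1 g2 g3 g4 g5 g6
    exact vdc_abs (qq k) (qd k) (qdd k) y1 y2 c C hy hc hC
      (fun y h => qq_deriv k y (hy1.trans_le h.1)) (fun y h => qd_deriv k y (hy1.trans_le h.1)) h4
      h1 h2 h3 lam D hlam hD G G' g1 g2 g3 g4 g5 g6


/-- A twice differentiable weight `w` supported in `(A,B)`, with derivatives `w1`, `w2`. -/
structure Wt (A B : ℝ) (w w1 w2 : ℝ → ℝ) : Prop where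
  d1 : ∀ z, HasDerivAt w (w1 z) z
  d2 : ∀ z, HasDerivAt w1 (w2 z) z
  c2 : Continuous w2
  s0 : ∀ z, z ∉ Set.Ioo A B → w z = 0
  s1 : ∀ z, z ∉ Set.Ioo A B → w1 z = 0

noncomputable def cc (k : ℝ) (w : ℝ → ℝ) (A B t x : ℝ) : ℂ :=
  ∫ z in A..B, (w z : ℂ) * ee (t * (z ^ k - k * x ^ (k - 1) * z + (k - 1) * x ^ k))

lemma qq_continuous (k : ℝ) (hk : 1 < k) : Continuous (qq k) := by
  unfold qq
  have := Real.continuous_rpow_const (q := k) (by linarith)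
  fun_prop

lemma cc_eq (k : ℝ) (w : ℝ → ℝ) (A B t x y1 y2 : ℝ) (hA : 0 < A)
    (hw : ∀ z, z ∉ Set.Ioo A B → w z = 0) (hx : 0 < x) 
    (h1 : x * y1 ≤ A) (h2 : B ≤ x * y2) :
    cc k w A B t x = ∫ y in y1..y2, ((x * w (x * y) : ℝ) : ℂ) * ee (t * x ^ k * qq k y) := by
  set h : ℝ → ℂ := fun z => (w z : ℂ) * ee (t * (z ^ k - k * x ^ (k - 1) * z + (k - 1) * x ^ k)) with hh
  have hsupp : Function.support h ⊆ Set.Ioo A B := by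
    intro z hz
    by_contra hc
    apply hz
    simp [hh, hw z hc]
  have e1 : ∫ y in y1..y2, ((x * w (x * y) : ℝ) : ℂ) * ee (t * x ^ k * qq k y)
      = ∫ y in y1..y2, (x : ℂ) * h (x * y) := by
    congr 1; ext y
    by_cases hy : x * y ∈ Set.Ioo A B
    · have hy0 : 0 < y := by
        by_contra! hc
        have := hy.1
        nlinarith
      simp only [hh, qq]
      rw [Real.mul_rpow hx.le hy0.le]
      have : x ^ k = x ^ (k - 1) * x := by
        rw [← Real.rpow_add_one hx.ne']; congr 1; ring
      rw [this]; push_cast; rw [mul_assoc]; congr 3; ring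
    · simp [hh, hw _ hy]
  rw [e1, intervalIntegral.integral_const_mul, intervalIntegral.integral_comp_mul_left _ hx.ne']
  rw [intervalIntegral.integral_eq_integral_of_support_subset, Complex.real_smul, ← mul_assoc, Complex.ofReal_inv,
    mul_inv_cancel₀ (by exact_mod_cast hx.ne'), one_mul]
  · unfold cc
    rw [intervalIntegral.integral_eq_integral_of_support_subset]
    exact hsupp.trans Set.Ioo_subset_Ioc_self
  · intro z hz
    have := hsupp hz
    exact ⟨by linarith [this.1], by linarith [this.2]⟩

noncomputable def Gf (k : ℝ) (w w1 r : ℝ → ℝ) (x y : ℝ) : ℝ :=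
  w (x * y) + x * y * w1 (x * y) - k * (x * w1 (x * y) * r y + w (x * y) * deriv r y)

noncomputable def Gf' (k : ℝ) (w w1 w2 r : ℝ → ℝ) (x y : ℝ) : ℝ :=
  x * w1 (x * y) + (x * w1 (x * y) + x * y * (x * w2 (x * y)))
    - k * ((x * (x * w2 (x * y)) * r y + x * w1 (x * y) * deriv r y)
      + (x * w1 (x * y) * deriv r y + w (x * y) * deriv (deriv r) y))

lemma Gf_deriv {A B k : ℝ} {w w1 w2 r : ℝ → ℝ} (hW : Wt A B w w1 w2)
    (hr : ∀ y > 0, AnalyticAt ℝ r y) (x y : ℝ) (hy : 0 < y) :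
    HasDerivAt (Gf k w w1 r x) (Gf' k w w1 w2 r x y) y := by
  have hxy : HasDerivAt (fun y => x * y) x y := by simpa using (hasDerivAt_id y).const_mul x
  have h0 : HasDerivAt (fun y => w (x * y)) (w1 (x * y) * x) y := (hW.d1 (x * y)).comp y hxy
  have h1 : HasDerivAt (fun y => w1 (x * y)) (w2 (x * y) * x) y := (hW.d2 (x * y)).comp y hxy
  have hr1 : HasDerivAt r (deriv r y) y := (hr y hy).differentiableAt.hasDerivAt
  have hr2 : HasDerivAt (deriv r) (deriv (deriv r) y) y := (hr y hy).deriv.differentiableAt.hasDerivAt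
  have := (h0.add (hxy.mul h1)).sub ((((h1.const_mul x).mul hr1).add (h0.mul hr2)).const_mul k)
  refine HasDerivAt.congr_deriv (f := Gf k w w1 r x) this ?_
  unfold Gf'; ring

noncomputable def Fx (k : ℝ) (w w1 : ℝ → ℝ) (t x y : ℝ) : ℂ :=
  ((w (x * y) + x * (w1 (x * y) * y) : ℝ) : ℂ) * ee (t * x ^ k * qq k y)
   + ((x * w (x * y) : ℝ) : ℂ) * (((2 * π * (t * (k * x ^ (k - 1)) * qq k y) : ℝ) : ℂ) * Complex.I * ee (t * x ^ k * qq k y))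

lemma Fx_deriv {A B k : ℝ} {w w1 w2 : ℝ → ℝ} (hW : Wt A B w w1 w2) (t x y : ℝ) (hx : 0 < x) :
    HasDerivAt (fun x => ((x * w (x * y) : ℝ) : ℂ) * ee (t * x ^ k * qq k y)) (Fx k w w1 t x y) x := by
  have hxy : HasDerivAt (fun x => x * y) y x := by simpa using (hasDerivAt_id x).mul_const y
  have h0 : HasDerivAt (fun x => w (x * y)) (w1 (x * y) * y) x := (hW.d1 (x * y)).comp x hxy
  have h1 : HasDerivAt (fun x => x * w (x * y)) (1 * w (x * y) + x * (w1 (x * y) * y)) x := (hasDerivAt_id' x).mul h0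
  have h2 := Real.hasDerivAt_rpow_const (x := x) (p := k) (Or.inl hx.ne')
  have h3 := ee_hasDerivAt ((h2.const_mul t).mul_const (qq k y))
  refine HasDerivAt.congr_deriv (h1.ofReal_comp.mul h3) ?_
  unfold Fx
  rw [one_mul]

lemma Wt.cont {A B : ℝ} {w w1 w2 : ℝ → ℝ} (hW : Wt A B w w1 w2) : Continuous w :=
  continuous_iff_continuousAt.mpr fun z => (hW.d1 z).continuousAt
lemma Wt.cont1 {A B : ℝ} {w w1 w2 : ℝ → ℝ} (hW : Wt A B w w1 w2) : Continuous w1 :=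
  continuous_iff_continuousAt.mpr fun z => (hW.d2 z).continuousAt

lemma Fx_integral {A B k : ℝ} {w w1 w2 r : ℝ → ℝ} (hk : 1 < k) (hW : Wt A B w w1 w2)
    (hr : ∀ y > 0, AnalyticAt ℝ r y) (hrq : ∀ y > 0, r y * qd k y = qq k y) 
    (t x y1 y2 : ℝ) (hx : 0 < x) (hy1 : 0 < y1) (hy : y1 ≤ y2) (h1 : x * y1 ≤ A) (h2 : B ≤ x * y2) :
    ∫ y in y1..y2, Fx k w w1 t x y = ∫ y in y1..y2, ((Gf k w w1 r x y : ℝ) : ℂ) * ee (t * x ^ k * qq k y) := by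
  have hIcc : Set.uIcc y1 y2 = Set.Icc y1 y2 := Set.uIcc_of_le hy
  have hw := hW.cont
  have hw1 := hW.cont1
  have hq := qq_continuous k hk
  have hrc : ContinuousOn r (Set.Icc y1 y2) := fun y h => (hr y (hy1.trans_le h.1)).continuousAt.continuousWithinAt
  have hrc1 : ContinuousOn (deriv r) (Set.Icc y1 y2) := fun y h => (hr y (hy1.trans_le h.1)).deriv.continuousAt.continuousWithinAt
  have hqdc : ContinuousOn (qd k) (Set.Icc y1 y2) := fun y h => (qd_deriv k y (hy1.trans_le h.1)).continuousAt.continuousWithinAt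
  have w10 : w (x * y1) = 0 := hW.s0 _ (fun h => by linarith [h.1])
  have w20 : w (x * y2) = 0 := hW.s0 _ (fun h => by linarith [h.2])
  have hec : Continuous (fun y => ee (t * x ^ k * qq k y)) := by fun_prop
  have hparts := intervalIntegral.integral_mul_deriv_eq_deriv_mul (a := y1) (b := y2)
    (u := fun y => ((w (x * y) * r y : ℝ) : ℂ)) (u' := fun y => ((w1 (x * y) * x * r y + w (x * y) * deriv r y : ℝ) : ℂ))
    (v := fun y => ee (t * x ^ k * qq k y)) (v' := fun y => ((2 * π * (t * x ^ k * qd k y) : ℝ) : ℂ) * Complex.I * ee (t * x ^ k * qq k y))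
    (by
      rw [hIcc]; intro y hy
      have hxy : HasDerivAt (fun y => x * y) x y := by simpa using (hasDerivAt_id y).const_mul x
      have h0 : HasDerivAt (fun y => w (x * y)) (w1 (x * y) * x) y := (hW.d1 (x * y)).comp y hxy
      have hr1 : HasDerivAt r (deriv r y) y := (hr y (hy1.trans_le hy.1)).differentiableAt.hasDerivAt
      exact (h0.mul hr1).ofReal_comp)
    (by
      rw [hIcc]; intro y hy
      exact ee_hasDerivAt ((qq_deriv k y (hy1.trans_le hy.1)).const_mul _))
    (by
      apply ContinuousOn.intervalIntegrable
      rw [hIcc]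
      exact Complex.continuous_ofReal.comp_continuousOn (by fun_prop))
    (by
      apply ContinuousOn.intervalIntegrable
      rw [hIcc]
      refine ContinuousOn.mul (ContinuousOn.mul ?_ continuousOn_const) hec.continuousOn
      exact Complex.continuous_ofReal.comp_continuousOn (by fun_prop))
  simp only [w10, w20, zero_mul, Complex.ofReal_zero, sub_zero, zero_sub] at hparts
  have e1 : ∫ y in y1..y2, Fx k w w1 t x y = (∫ y in y1..y2, ((w (x * y) + x * (w1 (x * y) * y) : ℝ) : ℂ) * ee (t * x ^ k * qq k y))
      + k * ∫ y in y1..y2, ((w (x * y) * r y : ℝ) : ℂ) * (((2 * π * (t * x ^ k * qd k y) : ℝ) : ℂ) * Complex.I * ee (t * x ^ k * qq k y)) := by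
    rw [← intervalIntegral.integral_const_mul, ← intervalIntegral.integral_add]
    · apply intervalIntegral.integral_congr
      rw [hIcc]; intro y hy
      have hq' := hrq y (hy1.trans_le hy.1)
      have : x ^ k = x ^ (k - 1) * x := by
        rw [← Real.rpow_add_one hx.ne']; congr 1; ring
      simp only [Fx]
      rw [← hq', this]; push_cast; ring
    · apply Continuous.intervalIntegrable; fun_prop
    · apply ContinuousOn.intervalIntegrable
      rw [hIcc]
      refine ContinuousOn.mul continuousOn_const (ContinuousOn.mul ?_ (ContinuousOn.mul (ContinuousOn.mul ?_ continuousOn_const) hec.continuousOn))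
      · exact Complex.continuous_ofReal.comp_continuousOn (by fun_prop)
      · exact Complex.continuous_ofReal.comp_continuousOn (by fun_prop)
  rw [e1, hparts, mul_neg, ← sub_eq_add_neg, ← intervalIntegral.integral_const_mul, ← intervalIntegral.integral_sub]
  · apply intervalIntegral.integral_congr
    intro y hy
    simp only [Gf]; push_cast; ring
  · apply Continuous.intervalIntegrable; fun_prop
  · apply ContinuousOn.intervalIntegrable
    rw [hIcc]
    refine ContinuousOn.mul continuousOn_const (ContinuousOn.mul ?_ hec.continuousOn)
    exact Complex.continuous_ofReal.comp_continuousOn (by fun_prop)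

lemma Gf_bound {A B k : ℝ} {w w1 w2 r : ℝ → ℝ} (hW : Wt A B w w1 w2)
    (hr : ∀ y > 0, AnalyticAt ℝ r y) (x1 x2 y1 y2 : ℝ) (hy1 : 0 < y1) :
    ∃ D ≥ 0, ∀ x ∈ Set.Icc x1 x2, ∀ y ∈ Set.Icc y1 y2, 
      |Gf k w w1 r x y| ≤ D ∧ |Gf' k w w1 w2 r x y| ≤ D ∧ |x * w (x * y)| ≤ D ∧ |x * (w1 (x * y) * x)| ≤ D := by
  have hw := hW.cont
  have hw1 := hW.cont1
  have hw2 := hW.c2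
  set K := Set.Icc x1 x2 ×ˢ Set.Icc y1 y2 with hK
  have hKc : IsCompact K := isCompact_Icc.prod isCompact_Icc
  have hrc : ContinuousOn r (Set.Icc y1 y2) := fun y h => (hr y (hy1.trans_le h.1)).continuousAt.continuousWithinAt
  have hrc1 : ContinuousOn (deriv r) (Set.Icc y1 y2) := fun y h => (hr y (hy1.trans_le h.1)).deriv.continuousAt.continuousWithinAt
  have hrc2 : ContinuousOn (deriv (deriv r)) (Set.Icc y1 y2) := fun y h => (hr y (hy1.trans_le h.1)).deriv.deriv.continuousAt.continuousWithinAt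
  have hs : Set.MapsTo (fun p : ℝ × ℝ => p.2) K (Set.Icc y1 y2) := fun p hp => hp.2
  have r0 : ContinuousOn (fun p : ℝ × ℝ => r p.2) K := hrc.comp continuous_snd.continuousOn hs
  have r1 : ContinuousOn (fun p : ℝ × ℝ => deriv r p.2) K := hrc1.comp continuous_snd.continuousOn hs
  have r2 : ContinuousOn (fun p : ℝ × ℝ => deriv (deriv r) p.2) K := hrc2.comp continuous_snd.continuousOn hs
  obtain ⟨D1, h1⟩ := hKc.exists_bound_of_continuousOn (f := fun p : ℝ × ℝ => Gf k w w1 r p.1 p.2) (by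
    unfold Gf; fun_prop)
  obtain ⟨D2, h2⟩ := hKc.exists_bound_of_continuousOn (f := fun p : ℝ × ℝ => Gf' k w w1 w2 r p.1 p.2) (by
    unfold Gf'; fun_prop)
  obtain ⟨D3, h3⟩ := hKc.exists_bound_of_continuousOn (f := fun p : ℝ × ℝ => p.1 * w (p.1 * p.2)) (by
    fun_prop)
  obtain ⟨D4, h4⟩ := hKc.exists_bound_of_continuousOn (f := fun p : ℝ × ℝ => p.1 * (w1 (p.1 * p.2) * p.1)) (by
    fun_prop)
  refine ⟨|D1| + |D2| + |D3| + |D4|, by positivity, ?_⟩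
  intro x hx y hy
  have g1 := h1 (x, y) ⟨hx, hy⟩
  have g2 := h2 (x, y) ⟨hx, hy⟩
  have g3 := h3 (x, y) ⟨hx, hy⟩
  have g4 := h4 (x, y) ⟨hx, hy⟩
  simp only [Real.norm_eq_abs] at g1 g2 g3 g4
  have := le_abs_self D1
  have := le_abs_self D2
  have := le_abs_self D3
  have := le_abs_self D4
  have := abs_nonneg D1
  have := abs_nonneg D2
  have := abs_nonneg D3
  have := abs_nonneg D4
  refine ⟨?_, ?_, ?_, ?_⟩ <;> linarith


lemma stat_coeff (k : ℝ) (hk : 1 < k) {A B : ℝ} {w w1 w2 : ℝ → ℝ} (hW : Wt A B w w1 w2) (hA : 0 < A) (hAB : A < B)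
    (x1 x2 : ℝ) (hx1 : 0 < x1) (hx : x1 < x2) :
    ∃ C ≥ 0, ∀ t > 0, (∀ x ∈ Set.Ioo x1 x2, ‖cc k w A B t x‖ ≤ C / √t) ∧
     (∀ x ∈ Set.Ioo x1 x2, ∀ x' ∈ Set.Ioo x1 x2, ‖cc k w A B t x' - cc k w A B t x‖ ≤ C / √t * |x' - x|) := by
  have hx2 : 0 < x2 := hx1.trans hx
  set y1 := A / x2 with hy1d
  set y2 := B / x1 with hy2d
  have hy1 : 0 < y1 := by positivity
  have hy : y1 ≤ y2 := by
    have : A / x2 ≤ A / x1 := by gcongr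
    have : A / x1 ≤ B / x1 := by gcongr
    linarith
  have hxy1 : ∀ x ∈ Set.Ioo x1 x2, x * y1 ≤ A := by
    intro x h
    rw [hy1d, mul_div_assoc', div_le_iff₀ hx2]
    nlinarith [h.2]
  have hxy2 : ∀ x ∈ Set.Ioo x1 x2, B ≤ x * y2 := by
    intro x h
    rw [hy2d, mul_div_assoc', le_div_iff₀ hx1]
    nlinarith [h.1]
  obtain ⟨r, hr, hrq⟩ := rho_exists k hk
  obtain ⟨Cv, hCv, hv⟩ := vdc k hk y1 y2 hy1 hy
  obtain ⟨D, hD, hDb⟩ := Gf_bound (k := k) hW hr x1 x2 y1 y2 hy1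
  have hw := hW.cont
  have hw1 := hW.cont1
  have hw2 := hW.c2
  have hq := qq_continuous k hk
  have hIcc : Set.uIcc y1 y2 = Set.Icc y1 y2 := Set.uIcc_of_le hy
  refine ⟨Cv * D / √(x1 ^ k), by positivity, ?_⟩
  intro t ht
  have hscale : ∀ x ∈ Set.Ioo x1 x2, Cv * D / √(t * x ^ k) ≤ Cv * D / √(x1 ^ k) / √t := by
    intro x hx
    have hx0 : 0 < x := hx1.trans hx.1
    rw [Real.sqrt_mul ht.le, div_div, mul_comm (√(x1 ^ k))]
    have : 0 < x1 ^ k := Real.rpow_pos_of_pos hx1 k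
    have : 0 < √(x1 ^ k) := Real.sqrt_pos.mpr this
    have : 0 < √t := Real.sqrt_pos.mpr ht
    have := hx.1.le
    gcongr
  have hlam : ∀ x ∈ Set.Ioo x1 x2, 0 < t * x ^ k := by
    intro x hx
    have := Real.rpow_pos_of_pos (hx1.trans hx.1) k
    positivity
  have hx0 : ∀ x ∈ Set.Ioo x1 x2, 0 < x := fun x h => hx1.trans h.1
  constructor
  · intro x h
    rw [cc_eq k w A B t x y1 y2 hA hW.s0 (hx0 x h) (hxy1 x h) (hxy2 x h)]
    refine le_trans ?_ (hscale x h)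
    refine hv (t * x ^ k) D (hlam x h) hD (fun y => ((x * w (x * y) : ℝ) : ℂ)) (fun y => ((x * (w1 (x * y) * x) : ℝ) : ℂ)) ?_ ?_ ?_ ?_ ?_ ?_
    · intro y _
      have hxy : HasDerivAt (fun y => x * y) x y := by simpa using (hasDerivAt_id y).const_mul x
      have h0 : HasDerivAt (fun y => w (x * y)) (w1 (x * y) * x) y := (hW.d1 (x * y)).comp y hxy
      exact (h0.const_mul x).ofReal_comp
    · apply Continuous.continuousOn; fun_prop
    · simp [hW.s0 (x * y1) (fun g => by linarith [g.1, hxy1 x h])]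
    · simp [hW.s0 (x * y2) (fun g => by linarith [g.2, hxy2 x h])]
    · intro y hy
      rw [Complex.norm_real]
      exact (hDb x ⟨h.1.le, h.2.le⟩ y hy).2.2.1
    · intro y hy
      rw [Complex.norm_real]
      exact (hDb x ⟨h.1.le, h.2.le⟩ y hy).2.2.2
  · have hder : ∀ x ∈ Set.Ioo x1 x2, HasDerivAt (fun x => ∫ y in y1..y2, ((x * w (x * y) : ℝ) : ℂ) * ee (t * x ^ k * qq k y)) 
        (∫ y in y1..y2, Fx k w w1 t x y) x := by
      intro x h
      have c1 := Real.continuous_rpow_const (q := k) (by linarith)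
      have c2 := Real.continuous_rpow_const (q := k - 1) (by linarith)
      have hFc : Continuous (fun p : ℝ × ℝ => Fx k w w1 t p.1 p.2) := by
        unfold Fx
        unfold ee
        fun_prop
      obtain ⟨E, hE⟩ := (isCompact_Icc.prod isCompact_Icc : IsCompact (Set.Icc x1 x2 ×ˢ Set.Icc y1 y2)).exists_bound_of_continuousOn hFc.continuousOn
      have hcf : ∀ x : ℝ, Continuous (fun y => ((x * w (x * y) : ℝ) : ℂ) * ee (t * x ^ k * qq k y)) := by
        intro x; fun_prop
      have hcF : Continuous (Fx k w w1 t x) := hFc.comp (Continuous.prodMk_right x)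
      refine (intervalIntegral.hasDerivAt_integral_of_dominated_loc_of_deriv_le (bound := fun _ => E) 
        (Ioo_mem_nhds h.1 h.2) ?_ ?_ ?_ ?_ ?_ ?_).2
      · filter_upwards with x
        exact (hcf x).aestronglyMeasurable
      · exact (hcf x).intervalIntegrable _ _
      · exact hcF.aestronglyMeasurable
      · filter_upwards with y hy' x hx'
        rw [Set.uIoc_of_le hy] at hy'
        exact hE (x, y) ⟨⟨hx'.1.le, hx'.2.le⟩, ⟨hy'.1.le, hy'.2⟩⟩
      · simp
      · filter_upwards with y hy' x hx'
        exact Fx_deriv hW t x y (hx0 x hx')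
    have hbd : ∀ x ∈ Set.Ioo x1 x2, ‖∫ y in y1..y2, Fx k w w1 t x y‖ ≤ Cv * D / √(x1 ^ k) / √t := by
      intro x h
      rw [Fx_integral hk hW hr hrq t x y1 y2 (hx0 x h) hy1 hy (hxy1 x h) (hxy2 x h)]
      refine le_trans ?_ (hscale x h)
      refine hv (t * x ^ k) D (hlam x h) hD (fun y => ((Gf k w w1 r x y : ℝ) : ℂ)) (fun y => ((Gf' k w w1 w2 r x y : ℝ) : ℂ)) ?_ ?_ ?_ ?_ ?_ ?_
      · intro y hy
        exact (Gf_deriv hW hr x y (hy1.trans_le hy.1)).ofReal_comp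
      · have hrc : ContinuousOn r (Set.Icc y1 y2) := fun y h => (hr y (hy1.trans_le h.1)).continuousAt.continuousWithinAt
        have hrc1 : ContinuousOn (deriv r) (Set.Icc y1 y2) := fun y h => (hr y (hy1.trans_le h.1)).deriv.continuousAt.continuousWithinAt
        have hrc2 : ContinuousOn (deriv (deriv r)) (Set.Icc y1 y2) := fun y h => (hr y (hy1.trans_le h.1)).deriv.deriv.continuousAt.continuousWithinAt
        refine Complex.continuous_ofReal.comp_continuousOn ?_
        unfold Gf'; fun_prop
      · have g : x * y1 ∉ Set.Ioo A B := fun g => by linarith [g.1, hxy1 x h]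
        simp [Gf, hW.s0 _ g, hW.s1 _ g]
      · have g : x * y2 ∉ Set.Ioo A B := fun g => by linarith [g.2, hxy2 x h]
        simp [Gf, hW.s0 _ g, hW.s1 _ g]
      · intro y hy
        rw [Complex.norm_real]
        exact (hDb x ⟨h.1.le, h.2.le⟩ y hy).1
      · intro y hy
        rw [Complex.norm_real]
        exact (hDb x ⟨h.1.le, h.2.le⟩ y hy).2.1
    intro x h x' h'
    rw [cc_eq k w A B t x y1 y2 hA hW.s0 (hx0 x h) (hxy1 x h) (hxy2 x h),
      cc_eq k w A B t x' y1 y2 hA hW.s0 (hx0 x' h') (hxy1 x' h') (hxy2 x' h')]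
    exact (convex_Ioo x1 x2).norm_image_sub_le_of_norm_hasDerivWithin_le 
      (f := fun x => ∫ y in y1..y2, ((x * w (x * y) : ℝ) : ℂ) * ee (t * x ^ k * qq k y))
      (fun x hx => (hder x hx).hasDerivWithinAt) hbd h h'


lemma ibp_osc (A B t : ℝ) (ht : 0 < t) (hAB : A ≤ B) (u h v f f' : ℝ → ℝ) 
    (hf : ∀ z ∈ Set.Icc A B, HasDerivAt f (f' z) z) (hf'c : ContinuousOn f' (Set.Icc A B))
    (hh : ∀ z ∈ Set.Icc A B, h z * f' z = 1)
    (huh : ∀ z ∈ Set.Icc A B, HasDerivAt (fun z => u z * h z) (v z) z) (hvc : ContinuousOn v (Set.Icc A B))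
    (hu1 : u A = 0) (hu2 : u B = 0) :
    ‖∫ z in A..B, (u z : ℂ) * ee (t * f z)‖ ≤ 1 / t * ‖∫ z in A..B, (v z : ℂ) * ee (t * f z)‖ := by
  have hIcc : Set.uIcc A B = Set.Icc A B := Set.uIcc_of_le hAB
  have hfc : ContinuousOn f (Set.Icc A B) := fun y hy => (hf y hy).continuousAt.continuousWithinAt
  have hec : ContinuousOn (fun y => ee (t * f y)) (Set.Icc A B) :=
    ee_continuous.comp_continuousOn (by fun_prop)
  have hparts := intervalIntegral.integral_mul_deriv_eq_deriv_mul (a := A) (b := B)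
    (u := fun y => ((u y * h y : ℝ) : ℂ)) (u' := fun y => (v y : ℂ))
    (v := fun y => ee (t * f y)) (v' := fun y => ((2 * π * (t * f' y) : ℝ) : ℂ) * Complex.I * ee (t * f y))
    (by
      rw [hIcc]; intro y hy
      exact (huh y hy).ofReal_comp)
    (by
      rw [hIcc]; intro y hy
      exact ee_hasDerivAt ((hf y hy).const_mul _))
    (by
      apply ContinuousOn.intervalIntegrable
      rw [hIcc]
      exact Complex.continuous_ofReal.comp_continuousOn (by fun_prop))
    (by
      apply ContinuousOn.intervalIntegrable
      rw [hIcc]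
      refine ContinuousOn.mul (ContinuousOn.mul ?_ continuousOn_const) hec
      exact Complex.continuous_ofReal.comp_continuousOn (by fun_prop))
  simp only [hu1, hu2, zero_mul, Complex.ofReal_zero, sub_zero, zero_sub] at hparts
  have e1 : ∫ y in A..B, ((u y * h y : ℝ) : ℂ) * (((2 * π * (t * f' y) : ℝ) : ℂ) * Complex.I * ee (t * f y))
     = (((2 * π * t : ℝ) : ℂ) * Complex.I) * ∫ z in A..B, (u z : ℂ) * ee (t * f z) := by
    rw [← intervalIntegral.integral_const_mul]
    apply intervalIntegral.integral_congr
    rw [hIcc]; intro y hy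
    have h1 : (h y : ℂ) * f' y = 1 := by exact_mod_cast hh y hy
    simp only
    push_cast
    linear_combination (2 * (π : ℂ) * t * Complex.I * u y * ee (t * f y)) * h1
  rw [e1] at hparts
  have h2 := congrArg norm hparts
  rw [norm_mul, norm_neg, norm_mul, Complex.norm_I, mul_one, Complex.norm_real, Real.norm_eq_abs,
    abs_of_pos (by positivity)] at h2
  rw [← h2]
  have := Real.pi_gt_three
  have h3 : 1 / t * (2 * π * t * ‖∫ z in A..B, (u z : ℂ) * ee (t * f z)‖) = 2 * π * ‖∫ z in A..B, (u z : ℂ) * ee (t * f z)‖ := by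
    field_simp
  rw [h3]
  nlinarith [norm_nonneg (∫ z in A..B, (u z : ℂ) * ee (t * f z))]

lemma nonstat_gap (a b al be : ℝ) (ha : 0 < a) (hal0 : 0 ≤ al) (hal : al < a) (hbe : b < be) (hb : 0 < b) :
    ∃ c > 0, ∀ p s, (p < al ∨ be < p) → a ≤ s → s ≤ b → c * (1 + |p|) ≤ |s - p| := by
  have e1 : 0 < (a - al) / (1 + al) := by apply div_pos <;> linarith
  have e2 : 0 < (be - b) / (1 + be) := by apply div_pos <;> linarith
  refine ⟨min (min a 1) (min ((a - al) / (1 + al)) ((be - b) / (1 + be))), by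
    apply lt_min <;> apply lt_min <;> linarith, ?_⟩
  intro p s hp h1 h2
  set c := min (min a 1) (min ((a - al) / (1 + al)) ((be - b) / (1 + be))) with hc
  have c1 : c ≤ a := (min_le_left _ _).trans (min_le_left _ _)
  have c2 : c ≤ 1 := (min_le_left _ _).trans (min_le_right _ _)
  have c3 : c ≤ (a - al) / (1 + al) := (min_le_right _ _).trans (min_le_left _ _)
  have c4 : c ≤ (be - b) / (1 + be) := (min_le_right _ _).trans (min_le_right _ _)
  rw [le_div_iff₀ (by linarith)] at c3 c4
  rcases hp with hp | hp
  · have : s - p ≤ |s - p| := le_abs_self _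
    refine le_trans ?_ this
    rcases le_or_gt 0 p with h0 | h0
    · rw [abs_of_nonneg h0]
      have : (c * (1 + al)) * (1 + p) ≤ (a - al) * (1 + p) := by
        apply mul_le_mul_of_nonneg_right c3; linarith
      have h5 : (a - al) * (1 + p) ≤ (a - p) * (1 + al) := by nlinarith
      have : (c * (1 + p)) * (1 + al) ≤ (a - p) * (1 + al) := by linarith
      have := le_of_mul_le_mul_right this (by linarith)
      linarith
    · rw [abs_of_neg h0]
      nlinarith
  · have : -(s - p) ≤ |s - p| := neg_le_abs _
    refine le_trans ?_ this
    have h0 : 0 < p := by linarith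
    rw [abs_of_pos h0]
    have : (c * (1 + be)) * (1 + p) ≤ (be - b) * (1 + p) := by
      apply mul_le_mul_of_nonneg_right c4; linarith
    have h5 : (be - b) * (1 + p) ≤ (p - b) * (1 + be) := by nlinarith
    have : (c * (1 + p)) * (1 + be) ≤ (p - b) * (1 + be) := by linarith
    have := le_of_mul_le_mul_right this (by linarith)
    linarith

set_option maxHeartbeats 2000000 in
lemma nonstat (k : ℝ) (hk : 1 < k) {A B : ℝ} {w w1 w2 : ℝ → ℝ} (hW : Wt A B w w1 w2) (hA : 0 < A) (hAB : A < B)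
    (al be : ℝ) (hal0 : 0 ≤ al) (hal : al < A ^ (k - 1)) (hbe : B ^ (k - 1) < be) :
    ∃ C ≥ 0, ∀ t > 0, ∀ p, (p < al ∨ be < p) → 
      ‖∫ z in A..B, (w z : ℂ) * ee (t * (z ^ k - k * p * z))‖ ≤ C / (t ^ 2 * (1 + |p|) ^ 2) := by
  obtain ⟨c, hc, hgap⟩ := nonstat_gap (A ^ (k - 1)) (B ^ (k - 1)) al be (Real.rpow_pos_of_pos hA _) hal0 hal hbe (Real.rpow_pos_of_pos (hA.trans hAB) _)
  have hcw := hW.cont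
  have hcw1 := hW.cont1
  have hcw2 := hW.c2
  obtain ⟨W0, hW0⟩ := (isCompact_Icc : IsCompact (Set.Icc A B)).exists_bound_of_continuousOn hcw.continuousOn
  obtain ⟨W1, hW1⟩ := (isCompact_Icc : IsCompact (Set.Icc A B)).exists_bound_of_continuousOn hcw1.continuousOn
  obtain ⟨W2, hW2⟩ := (isCompact_Icc : IsCompact (Set.Icc A B)).exists_bound_of_continuousOn hcw2.continuousOn
  have hpc : ∀ s : ℝ, ContinuousOn (fun z : ℝ => z ^ s) (Set.Icc A B) := by
    intro s z hz
    exact (Real.continuousAt_rpow_const z s (Or.inl (hA.trans_le hz.1).ne')).continuousWithinAt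
  set f2 : ℝ → ℝ := fun z => k * ((k - 1) * z ^ (k - 1 - 1)) with hf2
  set f3 : ℝ → ℝ := fun z => k * ((k - 1) * ((k - 1 - 1) * z ^ (k - 1 - 1 - 1))) with hf3
  have hf2c : ContinuousOn f2 (Set.Icc A B) := by have := hpc (k - 1 - 1); fun_prop
  have hf3c : ContinuousOn f3 (Set.Icc A B) := by have := hpc (k - 1 - 1 - 1); fun_prop
  obtain ⟨M2, hM2⟩ := (isCompact_Icc : IsCompact (Set.Icc A B)).exists_bound_of_continuousOn hf2c
  obtain ⟨M3, hM3⟩ := (isCompact_Icc : IsCompact (Set.Icc A B)).exists_bound_of_continuousOn hf3c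
  set M := |W0| + |W1| + |W2| + |M2| + |M3| with hMdef
  have b0 := abs_nonneg W0
  have b1 := abs_nonneg W1
  have b2 := abs_nonneg W2
  have b3 := abs_nonneg M2
  have b4 := abs_nonneg M3
  have hM0 : 0 ≤ M := by positivity
  have B0 : ∀ z ∈ Set.Icc A B, |w z| ≤ M := fun z hz => by
    have := hW0 z hz; rw [Real.norm_eq_abs] at this; linarith [le_abs_self W0]
  have B1 : ∀ z ∈ Set.Icc A B, |w1 z| ≤ M := fun z hz => by
    have := hW1 z hz; rw [Real.norm_eq_abs] at this; linarith [le_abs_self W1]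
  have B2 : ∀ z ∈ Set.Icc A B, |w2 z| ≤ M := fun z hz => by
    have := hW2 z hz; rw [Real.norm_eq_abs] at this; linarith [le_abs_self W2]
  have B3 : ∀ z ∈ Set.Icc A B, |f2 z| ≤ M := fun z hz => by
    have := hM2 z hz; rw [Real.norm_eq_abs] at this; linarith [le_abs_self M2]
  have B4 : ∀ z ∈ Set.Icc A B, |f3 z| ≤ M := fun z hz => by
    have := hM3 z hz; rw [Real.norm_eq_abs] at this; linarith [le_abs_self M3]
  set H := 1 / c with hH
  have hH0 : 0 < H := by positivity
  set P := M * H ^ 2 with hP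
  have hP0 : 0 ≤ P := by positivity
  set R := M * H ^ 2 + 2 * M * H * P with hR
  have hR0 : 0 ≤ R := by positivity
  set E := ((M * H + M * P) + (M * P + M * R)) * H + (M * H + M * P) * P with hE
  have hE0 : 0 ≤ E := by positivity
  refine ⟨(B - A) * E, by have : 0 ≤ B - A := by linarith
                          positivity, ?_⟩
  intro t ht p hp
  set σ := 1 + |p| with hσ
  have hσ1 : 1 ≤ σ := by have := abs_nonneg p; linarith
  have hσ0 : 0 < σ := by linarith
  have hz0 : ∀ z ∈ Set.Icc A B, 0 < z := fun z hz => hA.trans_le hz.1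
  set f : ℝ → ℝ := fun z => z ^ k - k * p * z with hf
  set f1 : ℝ → ℝ := fun z => k * (z ^ (k - 1) - p) with hf1
  have hfd : ∀ z ∈ Set.Icc A B, HasDerivAt f (f1 z) z := by
    intro z hz
    have h1 := ((Real.hasDerivAt_rpow_const (x := z) (p := k) (Or.inl (hz0 z hz).ne')).sub
      ((hasDerivAt_id z).const_mul (k * p)))
    refine HasDerivAt.congr_deriv (f := f) h1 ?_
    simp only [hf1]; ring
  have hf1d : ∀ z ∈ Set.Icc A B, HasDerivAt f1 (f2 z) z := by
    intro z hz
    have h1 := ((Real.hasDerivAt_rpow_const (x := z) (p := k - 1) (Or.inl (hz0 z hz).ne')).sub_const p).const_mul k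
    exact h1
  have hf2d : ∀ z ∈ Set.Icc A B, HasDerivAt f2 (f3 z) z := by
    intro z hz
    have h1 := ((Real.hasDerivAt_rpow_const (x := z) (p := k - 1 - 1) (Or.inl (hz0 z hz).ne')).const_mul (k - 1)).const_mul k
    exact h1
  have hf1low : ∀ z ∈ Set.Icc A B, c * σ ≤ |f1 z| := by
    intro z hz
    have h1 := hgap p (z ^ (k - 1)) hp (Real.rpow_le_rpow hA.le hz.1 (by linarith)) (Real.rpow_le_rpow (hz0 z hz).le hz.2 (by linarith))
    simp only [hf1, abs_mul, abs_of_pos (by linarith : 0 < k)]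
    have h0 := abs_nonneg (z ^ (k - 1) - p)
    exact h1.trans (le_mul_of_one_le_left h0 hk.le)
  have hf1ne : ∀ z ∈ Set.Icc A B, f1 z ≠ 0 := by
    intro z hz h0
    have := hf1low z hz
    rw [h0, abs_zero] at this
    have : 0 < c * σ := by positivity
    linarith
  set h : ℝ → ℝ := fun z => (f1 z)⁻¹ with hh
  set h1 : ℝ → ℝ := fun z => -(f2 z * (h z * h z)) with hh1
  set h2 : ℝ → ℝ := fun z => -(f3 z * (h z * h z) + f2 z * (h1 z * h z + h z * h1 z)) with hh2
  have hhd : ∀ z ∈ Set.Icc A B, HasDerivAt h (h1 z) z := by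
    intro z hz
    refine HasDerivAt.congr_deriv (f := h) ((hf1d z hz).inv (hf1ne z hz)) ?_
    simp only [hh1, hh]
    have := hf1ne z hz
    field_simp
  have hh1d : ∀ z ∈ Set.Icc A B, HasDerivAt h1 (h2 z) z := by
    intro z hz
    exact ((hf2d z hz).mul ((hhd z hz).mul (hhd z hz))).neg
  have bh : ∀ z ∈ Set.Icc A B, |h z| ≤ H / σ := by
    intro z hz
    simp only [hh, abs_inv, hH]
    rw [div_div, ← one_div]
    exact one_div_le_one_div_of_le (by positivity) (hf1low z hz)
  have hHσ : H / σ ≤ H := div_le_self hH0.le hσ1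
  have bh1 : ∀ z ∈ Set.Icc A B, |h1 z| ≤ P / σ := by
    intro z hz
    simp only [hh1, abs_neg, abs_mul]
    calc |f2 z| * (|h z| * |h z|) ≤ M * (H * (H / σ)) := by
          have := bh z hz
          have := B3 z hz
          have : |h z| ≤ H := by linarith
          gcongr
      _ = P / σ := by rw [hP]; ring
  have bh2 : ∀ z ∈ Set.Icc A B, |h2 z| ≤ R / σ := by
    intro z hz
    simp only [hh2, abs_neg]
    have g1 := bh z hz
    have g2 : |h z| ≤ H := by linarith
    have g3 := B3 z hz
    have g4 := B4 z hz
    have g5 := bh1 z hz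
    calc _ ≤ |f3 z * (h z * h z)| + |f2 z * (h1 z * h z + h z * h1 z)| := abs_add_le _ _
      _ = |f3 z| * (|h z| * |h z|) + 2 * |f2 z| * (|h z| * |h1 z|) := by
          rw [show h1 z * h z + h z * h1 z = 2 * (h z * h1 z) by ring]
          simp only [abs_mul, abs_two]; ring
      _ ≤ M * (H * (H / σ)) + 2 * M * (H * (P / σ)) := by gcongr
      _ = R / σ := by rw [hR]; ring
  set u1 : ℝ → ℝ := fun z => w1 z * h z + w z * h1 z with hu1
  set u1' : ℝ → ℝ := fun z => (w2 z * h z + w1 z * h1 z) + (w1 z * h1 z + w z * h2 z) with hu1'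
  set u2 : ℝ → ℝ := fun z => u1' z * h z + u1 z * h1 z with hu2
  have hwd : ∀ z ∈ Set.Icc A B, HasDerivAt (fun z => w z * h z) (u1 z) z := fun z hz => (hW.d1 z).mul (hhd z hz)
  have hu1d : ∀ z ∈ Set.Icc A B, HasDerivAt u1 (u1' z) z := fun z hz => 
    ((hW.d2 z).mul (hhd z hz)).add ((hW.d1 z).mul (hh1d z hz))
  have hu1hd : ∀ z ∈ Set.Icc A B, HasDerivAt (fun z => u1 z * h z) (u2 z) z := fun z hz => (hu1d z hz).mul (hhd z hz)
  have cf1 : ContinuousOn f1 (Set.Icc A B) := fun z hz => (hf1d z hz).continuousAt.continuousWithinAt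
  have ch : ContinuousOn h (Set.Icc A B) := fun z hz => (hhd z hz).continuousAt.continuousWithinAt
  have ch1 : ContinuousOn h1 (Set.Icc A B) := fun z hz => (hh1d z hz).continuousAt.continuousWithinAt
  have ch2 : ContinuousOn h2 (Set.Icc A B) := by fun_prop
  have cu1 : ContinuousOn u1 (Set.Icc A B) := fun z hz => (hu1d z hz).continuousAt.continuousWithinAt
  have cu2 : ContinuousOn u2 (Set.Icc A B) := by fun_prop
  have hAn : A ∉ Set.Ioo A B := fun g => lt_irrefl _ g.1
  have hBn : B ∉ Set.Ioo A B := fun g => lt_irrefl _ g.2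
  have s1 := ibp_osc A B t ht hAB.le w h u1 f f1 hfd cf1 (fun z hz => inv_mul_cancel₀ (hf1ne z hz)) hwd cu1 (hW.s0 A hAn) (hW.s0 B hBn)
  have s2 := ibp_osc A B t ht hAB.le u1 h u2 f f1 hfd cf1 (fun z hz => inv_mul_cancel₀ (hf1ne z hz)) hu1hd cu2 
    (by simp [hu1, hW.s0 A hAn, hW.s1 A hAn]) (by simp [hu1, hW.s0 B hBn, hW.s1 B hBn])
  have bu1 : ∀ z ∈ Set.Icc A B, |u1 z| ≤ (M * H + M * P) / σ := by
    intro z hz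
    have g0 := B0 z hz
    have g1 := B1 z hz
    have g2 := bh z hz
    have g3 := bh1 z hz
    calc _ ≤ |w1 z * h z| + |w z * h1 z| := abs_add_le _ _
      _ ≤ M * (H / σ) + M * (P / σ) := by rw [abs_mul, abs_mul]; gcongr
      _ = _ := by ring
  have bu1' : ∀ z ∈ Set.Icc A B, |u1' z| ≤ ((M * H + M * P) + (M * P + M * R)) / σ := by
    intro z hz
    have g0 := B0 z hz
    have g1 := B1 z hz
    have g1' := B2 z hz
    have g2 := bh z hz
    have g3 := bh1 z hz
    have g4 := bh2 z hz
    calc _ ≤ |w2 z * h z + w1 z * h1 z| + |w1 z * h1 z + w z * h2 z| := abs_add_le _ _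
      _ ≤ (|w2 z * h z| + |w1 z * h1 z|) + (|w1 z * h1 z| + |w z * h2 z|) := add_le_add (abs_add_le _ _) (abs_add_le _ _)
      _ ≤ (M * (H / σ) + M * (P / σ)) + (M * (P / σ) + M * (R / σ)) := by simp only [abs_mul]; gcongr
      _ = _ := by ring
  have bu2 : ∀ z ∈ Set.Icc A B, |u2 z| ≤ E / σ ^ 2 := by
    intro z hz
    have g2 := bh z hz
    have g3 := bh1 z hz
    have g4 := bu1 z hz
    have g5 := bu1' z hz
    calc _ ≤ |u1' z * h z| + |u1 z * h1 z| := abs_add_le _ _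
      _ ≤ ((M * H + M * P) + (M * P + M * R)) / σ * (H / σ) + (M * H + M * P) / σ * (P / σ) := by
          rw [abs_mul, abs_mul]; gcongr
      _ = _ := by rw [hE]; ring
  have s3 : ‖∫ z in A..B, (u2 z : ℂ) * ee (t * f z)‖ ≤ E / σ ^ 2 * |B - A| := by
    apply intervalIntegral.norm_integral_le_of_norm_le_const
    intro z hz
    rw [Set.uIoc_of_le hAB.le] at hz
    rw [norm_mul, ee_norm, mul_one, Complex.norm_real]
    exact bu2 z ⟨hz.1.le, hz.2⟩
  rw [abs_of_pos (by linarith)] at s3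
  calc _ ≤ 1 / t * (1 / t * (E / σ ^ 2 * (B - A))) := by
        refine s1.trans ?_
        have := s2.trans (mul_le_mul_of_nonneg_left s3 (by positivity))
        gcongr
    _ = _ := by field_simp


noncomputable def II (k : ℝ) (w : ℝ → ℝ) (A B t p : ℝ) : ℂ :=
  ∫ z in A..B, (w z : ℂ) * ee (t * (z ^ k - k * p * z))

lemma fourier_g (k : ℝ) (hk : 1 < k) {A B : ℝ} {w w1 w2 : ℝ → ℝ} (hW : Wt A B w w1 w2)
    (N t : ℝ) (hN : 0 < N) (ht : 0 < t) (m : ℝ) :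
    FourierTransform.fourier (fun x : ℝ => (w (x / N) : ℂ) * ee (t * (x / N) ^ k)) m
      = N * II k w A B t (m * N / (k * t)) := by
  rw [Real.fourier_real_eq_integral_exp_smul]
  set h : ℝ → ℂ := fun z => (w z : ℂ) * ee (t * (z ^ k - k * (m * N / (k * t)) * z)) with hh
  have e1 : ∀ v : ℝ, Complex.exp (↑(-2 * π * v * m) * Complex.I) • ((w (v / N) : ℂ) * ee (t * (v / N) ^ k)) = h (v / N) := by
    intro v
    simp only [hh, smul_eq_mul]
    rw [show t * ((v / N) ^ k - k * (m * N / (k * t)) * (v / N)) = t * (v / N) ^ k + (- v * m) by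
      have : k ≠ 0 := by linarith
      field_simp; ring]
    rw [ee_add, show Complex.exp (↑(-2 * π * v * m) * Complex.I) = ee (- v * m) by
      unfold ee; congr 3; ring]
    ring
  simp_rw [e1]
  rw [MeasureTheory.Measure.integral_comp_div h N, abs_of_pos hN, Complex.real_smul]
  congr 1
  unfold II
  rw [intervalIntegral.integral_eq_integral_of_support_subset]
  intro z hz
  have : z ∈ Set.Ioo A B := by
    by_contra hc
    apply hz
    simp [hW.s0 z hc]
  exact ⟨this.1, this.2.le⟩

lemma poisson_bd (k : ℝ) (hk : 1 < k) {A B : ℝ} {w w1 w2 : ℝ → ℝ} (hW : Wt A B w w1 w2) (hA : 0 < A) (hAB : A < B)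
    (al be : ℝ) (hal0 : 0 < al) (hal : al < A ^ (k - 1)) (hbe : B ^ (k - 1) < be) :
    ∃ C ≥ 0, ∀ N ≥ (1:ℝ), ∀ t ≥ N, ∀ (s J : Finset ℕ), (∀ n : ℕ, A * N < n → n < B * N → n ∈ s) →
      (∀ m : ℕ, al * (k * t) ≤ m * N → m * N ≤ be * (k * t) → m ∈ J) → 
      ‖∑ n ∈ s, (w (n / N) : ℂ) * ee (t * (n / N) ^ k)‖ 
        ≤ C + ‖∑ m ∈ J, (N : ℂ) * II k w A B t (m * N / (k * t))‖ := by
  obtain ⟨C, hC, hns⟩ := nonstat k hk hW hA hAB al be hal0.le hal hbe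
  set Z := ∑' d : ℤ, 1 / (1 + (d : ℝ) ^ 2) with hZ
  have hZ0 : 0 ≤ Z := tsum_nonneg (fun d => by positivity)
  refine ⟨C * k ^ 2 * Z, by positivity, ?_⟩
  intro N hN t ht s J hs hJ
  have hN0 : 0 < N := by linarith
  have ht0 : 0 < t := by linarith
  have hk0 : 0 < k := by linarith
  set g : ℝ → ℂ := fun x : ℝ => (w (x / N) : ℂ) * ee (t * (x / N) ^ k) with hg
  have hgz : ∀ x : ℝ, ¬ (A * N < x ∧ x < B * N) → g x = 0 := by
    intro x hx
    have : x / N ∉ Set.Ioo A B := by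
      rintro ⟨h1, h2⟩
      rw [lt_div_iff₀ hN0] at h1
      rw [div_lt_iff₀ hN0] at h2
      exact hx ⟨h1, h2⟩
    simp [hg, hW.s0 _ this]
  have hgc : Continuous g := by
    have := hW.cont
    have := Real.continuous_rpow_const (q := k) hk0.le
    simp only [hg]
    fun_prop
  set a : ℤ → ℂ := fun m => N * II k w A B t ((m : ℝ) * N / (k * t)) with ha
  set J' : Finset ℤ := J.map Nat.castEmbedding with hJ'
  have hab : ∀ m : ℤ, m ∉ J' → ‖a m‖ ≤ C * k ^ 2 * (1 / (1 + (m : ℝ) ^ 2)) := by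
    intro m hm
    have hp : (m : ℝ) * N / (k * t) < al ∨ be < (m : ℝ) * N / (k * t) := by
      by_contra! hcon
      obtain ⟨h1, h2⟩ := hcon
      rw [le_div_iff₀ (by positivity)] at h1
      rw [div_le_iff₀ (by positivity)] at h2
      have hm0 : 0 < m := by
        have : 0 < (m : ℝ) * N := lt_of_lt_of_le (by positivity) h1
        have := (pos_iff_pos_of_mul_pos this).mpr hN0
        exact_mod_cast this
      obtain ⟨n, rfl⟩ := Int.eq_ofNat_of_zero_le hm0.le
      apply hm
      rw [hJ', Finset.mem_map]
      exact ⟨n, hJ n (by simpa using h1) (by simpa using h2), rfl⟩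
    have h1 := hns t ht0 _ hp
    simp only [ha, norm_mul, Complex.norm_real, Real.norm_eq_abs, abs_of_pos hN0]
    have h2 : N * (1 + |(m:ℝ)|) / k ≤ t * (1 + |(m : ℝ) * N / (k * t)|) := by
      rw [abs_div, abs_mul, abs_of_pos hN0, abs_of_pos (by positivity : 0 < k * t), div_le_iff₀ hk0]
      have : t * (1 + |(m:ℝ)| * N / (k * t)) * k = t * k + |(m:ℝ)| * N := by field_simp
      rw [this]; nlinarith
    have h3 : 1 + (m:ℝ) ^ 2 ≤ (1 + |(m:ℝ)|) ^ 2 := by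
      rw [← sq_abs (m:ℝ)]; nlinarith [abs_nonneg (m:ℝ)]
    calc N * ‖II k w A B t (↑m * N / (k * t))‖ ≤ N * (C / (t ^ 2 * (1 + |(m : ℝ) * N / (k * t)|) ^ 2)) := by
          gcongr; exact h1
      _ ≤ N * (C / (N * (1 + |(m:ℝ)|) / k) ^ 2) := by
          rw [← mul_pow]; gcongr
      _ = (1 / N) * (C * k ^ 2 * (1 / (1 + |(m:ℝ)|) ^ 2)) := by field_simp
      _ ≤ 1 * (C * k ^ 2 * (1 / (1 + (m : ℝ) ^ 2))) := by
          gcongr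
          rw [div_le_one hN0]; exact hN
      _ = _ := one_mul _
  set a' : ℤ → ℂ := fun m => if m ∈ J' then 0 else a m with ha'
  set a'' : ℤ → ℂ := fun m => if m ∈ J' then a m else 0 with ha''
  have hsum' : Summable (fun m : ℤ => C * k ^ 2 * (1 / (1 + (m : ℝ) ^ 2))) := summable_inv_one_add_sq.mul_left _
  have hb' : ∀ m, ‖a' m‖ ≤ C * k ^ 2 * (1 / (1 + (m : ℝ) ^ 2)) := by
    intro m
    simp only [ha']
    split_ifs with h
    · rw [norm_zero]; positivity
    · exact hab m h
  have hs1 : Summable a' := Summable.of_norm_bounded hsum' hb'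
  have hz'' : ∀ m ∉ J', a'' m = 0 := by intro m hm; simp [ha'', hm]
  have hs2 : Summable a'' := summable_of_ne_finset_zero hz''
  have hadd : a = fun m => a' m + a'' m := by
    ext m; simp only [ha', ha'']; split_ifs <;> simp
  have hsa : Summable a := by rw [hadd]; exact hs1.add hs2
  have hF : ∀ m : ℤ, FourierTransform.fourier g (m : ℝ) = a m := fun m => fourier_g k hk hW N t hN0 ht0 m
  have hP := Real.tsum_eq_tsum_fourier_of_rpow_decay_of_summable hgc (b := 2) (by norm_num) (by
    apply Asymptotics.IsBigO.of_bound 1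
    have : (Metric.closedBall (0:ℝ) (B * N))ᶜ ∈ Filter.cocompact ℝ := (isCompact_closedBall _ _).compl_mem_cocompact
    filter_upwards [this] with x hx
    rw [hgz x, norm_zero]
    · positivity
    · rintro ⟨h1, h2⟩
      apply hx
      have : 0 < A * N := by positivity
      simp only [Metric.mem_closedBall, dist_zero_right, Real.norm_eq_abs]
      rw [abs_of_pos (by linarith)]; exact h2.le) (by simp_rw [hF]; exact hsa) 0
  simp only [hF, zero_add, QuotientAddGroup.mk_zero, fourier_eval_zero, mul_one] at hP
  have hL : ∑' n : ℤ, g n = ∑ n ∈ s, (w (n / N) : ℂ) * ee (t * (n / N) ^ k) := by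
    rw [tsum_eq_sum (s := s.map Nat.castEmbedding), Finset.sum_map]
    · simp [hg]
    · intro n hn
      apply hgz
      rintro ⟨h1, h2⟩
      have hn0 : 0 < n := by
        have : (0:ℝ) < n := lt_trans (by positivity) h1
        exact_mod_cast this
      obtain ⟨j, rfl⟩ := Int.eq_ofNat_of_zero_le hn0.le
      apply hn
      rw [Finset.mem_map]
      exact ⟨j, hs j (by simpa using h1) (by simpa using h2), rfl⟩
  have hR : ∑' m, a m = ∑' m, a' m + ∑ m ∈ J, (N : ℂ) * II k w A B t (m * N / (k * t)) := by
    rw [hadd, hs1.tsum_add hs2, tsum_eq_sum hz'']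
    congr 1
    rw [Finset.sum_congr rfl (g := a) (fun m hm => by simp [ha'', hm]), hJ', Finset.sum_map]
    simp [ha]
  rw [← hL, hP, hR]
  refine (norm_add_le _ _).trans ?_
  gcongr
  refine (tsum_of_norm_bounded hsum'.hasSum hb').trans ?_
  rw [tsum_mul_left]


lemma abel_bd (b c : ℕ → ℂ) (n : ℕ) (R V : ℝ) (hR0 : 0 ≤ R) (hV0 : 0 ≤ V)
    (hR : ∀ j ≤ n, ‖∑ i ∈ Finset.range j, b i‖ ≤ R)
    (hV : ∀ i < n, ‖c i‖ ≤ V) (hV' : ∑ i ∈ Finset.range (n - 1), ‖c (i + 1) - c i‖ ≤ V) :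
    ‖∑ i ∈ Finset.range n, c i * b i‖ ≤ 2 * V * R := by
  have h := Finset.sum_range_by_parts c b n
  simp only [smul_eq_mul] at h
  rw [h]
  refine (norm_sub_le _ _).trans ?_
  have h1 : ‖c (n - 1) * ∑ i ∈ Finset.range n, b i‖ ≤ V * R := by
    rw [norm_mul]
    rcases Nat.eq_zero_or_pos n with h0 | h0
    · subst h0; simp; positivity
    · exact mul_le_mul (hV _ (by omega)) (hR n le_rfl) (norm_nonneg _) hV0
  have h2 : ‖∑ i ∈ Finset.range (n - 1), (c (i + 1) - c i) * ∑ j ∈ Finset.range (i + 1), b j‖ ≤ V * R := by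
    refine (norm_sum_le _ _).trans ?_
    calc _ ≤ ∑ i ∈ Finset.range (n - 1), ‖c (i + 1) - c i‖ * R := by
          apply Finset.sum_le_sum
          intro i hi
          rw [Finset.mem_range] at hi
          rw [norm_mul]
          exact mul_le_mul_of_nonneg_left (hR _ (by omega)) (norm_nonneg _)
      _ = (∑ i ∈ Finset.range (n - 1), ‖c (i + 1) - c i‖) * R := by rw [Finset.sum_mul]
      _ ≤ V * R := by gcongr
  linarith

noncomputable def phi (k N t : ℝ) : ℝ := -((k - 1) * (N / k) ^ (k / (k - 1)) * t ^ (1 - k / (k - 1)))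

lemma II_eq (k : ℝ) (hk : 1 < k) (w : ℝ → ℝ) (A B t N m : ℝ) (hN : 0 < N) (ht : 0 < t) (hm : 0 < m) :
    II k w A B t (m * N / (k * t)) = cc k w A B t ((m * N / (k * t)) ^ (1 / (k - 1))) 
      * ee (phi k N t * m ^ (k / (k - 1))) := by
  have hk0 : 0 < k := by linarith
  have hk1 : 0 < k - 1 := by linarith
  set p := m * N / (k * t) with hp
  have hp0 : 0 < p := by positivity
  unfold II cc
  rw [← intervalIntegral.integral_mul_const]
  congr 1; ext z
  rw [mul_assoc (w z : ℂ), ← ee_add]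
  congr 2
  rw [← Real.rpow_mul hp0.le, ← Real.rpow_mul hp0.le, one_div_mul_cancel hk1.ne', Real.rpow_one, one_div_mul_eq_div]
  have : t * p ^ (k / (k - 1)) = (N / k) ^ (k / (k - 1)) * t ^ (1 - k / (k - 1)) * m ^ (k / (k - 1)) := by
    rw [hp, show m * N / (k * t) = m * (N / k) * t⁻¹ by field_simp, Real.mul_rpow (by positivity) (by positivity),
      Real.mul_rpow (by positivity) (by positivity), Real.rpow_sub ht, Real.rpow_one, Real.inv_rpow ht.le]
    ring
  unfold phi
  linear_combination (-(k - 1)) * this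

lemma bproc (k : ℝ) (hk : 1 < k) {A B : ℝ} {w w1 w2 : ℝ → ℝ} (hW : Wt A B w w1 w2) (hA : 0 < A) (hAB : A < B)
    (al be : ℝ) (hal0 : 0 < al) (hal : al < A ^ (k - 1)) (hbe : B ^ (k - 1) < be) :
    ∃ C ≥ 0, ∀ N ≥ (1:ℝ), ∀ T ≥ N, ∀ t ∈ Set.Icc T (2 * T), ∀ (s : Finset ℕ), (∀ n : ℕ, A * N < n → n < B * N → n ∈ s) →
      ∀ (m1 n : ℕ), (∀ m : ℕ, al * (k * T) ≤ m * N → m * N ≤ be * (k * (2 * T)) → m1 ≤ m ∧ m < m1 + n) → 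
      (∀ i < n, al * (k * T) ≤ ((m1 + i : ℕ) : ℝ) * N ∧ ((m1 + i : ℕ) : ℝ) * N ≤ be * (k * (2 * T))) → 
      ∀ R ≥ 0, (∀ j ≤ n, ‖∑ i ∈ Finset.range j, ee (phi k N t * ((m1 + i : ℕ) : ℝ) ^ (k / (k - 1)))‖ ≤ R) → 
      ‖∑ n ∈ s, (w (n / N) : ℂ) * ee (t * (n / N) ^ k)‖ ≤ C + C * (N / √t) * R := by
  have hk0 : 0 < k := by linarith
  have hk1 : 0 < k - 1 := by linarith
  have hbe0 : 0 < be := lt_trans (Real.rpow_pos_of_pos (hA.trans hAB) _) hbe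
  have halbe : al < be := by
    have : A ^ (k - 1) < B ^ (k - 1) := Real.rpow_lt_rpow hA.le hAB hk1
    linarith
  obtain ⟨C1, hC1, hpo⟩ := poisson_bd k hk hW hA hAB al be hal0 hal hbe
  set x1 := (al / 4) ^ (1 / (k - 1)) with hx1
  set x2 := (4 * be) ^ (1 / (k - 1)) with hx2
  have hx10 : 0 < x1 := by positivity
  have he : 0 < 1 / (k - 1) := by positivity
  have hx12 : x1 < x2 := Real.rpow_lt_rpow (by positivity) (by linarith) he
  obtain ⟨C2, hC2, hst⟩ := stat_coeff k hk hW hA hAB x1 x2 hx10 hx12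
  set K := C2 * (1 + (x2 - x1)) with hK
  have hK0 : 0 ≤ K := mul_nonneg hC2 (by linarith)
  refine ⟨C1 + 2 * K, by positivity, ?_⟩
  intro N hN T hT t ht s hs m1 n hm1 hm2 R hR hpre
  have hN0 : 0 < N := by linarith
  have hT0 : 0 < T := by linarith
  have ht0 : 0 < t := by linarith [ht.1]
  have hsq : 0 < √t := Real.sqrt_pos.mpr ht0
  have h1 := hpo N hN t (by linarith [ht.1]) s (Finset.Ico m1 (m1 + n)) hs (by
    intro m h1 h2
    rw [Finset.mem_Ico]
    apply hm1
    · refine le_trans ?_ h1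
      have := ht.1
      gcongr
    · refine h2.trans ?_
      have := ht.2
      gcongr)
  rw [← Finset.mul_sum, norm_mul, Complex.norm_real, Real.norm_eq_abs, abs_of_pos hN0, Finset.sum_Ico_eq_sum_range,
    Nat.add_sub_cancel_left] at h1
  set X : ℕ → ℝ := fun i => (((m1 + i : ℕ) : ℝ) * N / (k * t)) ^ (1 / (k - 1)) with hX
  set c : ℕ → ℂ := fun i => cc k w A B t (X i) with hc
  set b : ℕ → ℂ := fun i => ee (phi k N t * ((m1 + i : ℕ) : ℝ) ^ (k / (k - 1))) with hb
  have hpos : ∀ i < n, 0 < ((m1 + i : ℕ) : ℝ) := by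
    intro i hi
    have h2 := (hm2 i hi).1
    have h3 : 0 < ((m1 + i : ℕ) : ℝ) * N := lt_of_lt_of_le (by positivity) h2
    exact (pos_iff_pos_of_mul_pos h3).mpr hN0
  have hXin : ∀ i < n, X i ∈ Set.Ioo x1 x2 := by
    intro i hi
    obtain ⟨h2, h3⟩ := hm2 i hi
    have := hpos i hi
    constructor
    · apply Real.rpow_lt_rpow (by positivity) _ he
      rw [lt_div_iff₀ (by positivity)]
      have : k * t ≤ k * (2 * T) := by have := ht.2; gcongr
      have : al / 4 * (k * t) ≤ al / 4 * (k * (2 * T)) := by gcongr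
      have : 0 < al * (k * T) := by positivity
      nlinarith
    · apply Real.rpow_lt_rpow (by positivity) _ he
      rw [div_lt_iff₀ (by positivity)]
      have : k * T ≤ k * t := by have := ht.1; gcongr
      have : be * (k * T) ≤ be * (k * t) := by gcongr
      have : 0 < be * (k * T) := by positivity
      nlinarith
  have hXmono : ∀ i, X i ≤ X (i + 1) := by
    intro i
    simp only [hX]
    gcongr
    omega
  have hsumeq : ∑ i ∈ Finset.range n, II k w A B t (((m1 + i : ℕ) : ℝ) * N / (k * t)) = ∑ i ∈ Finset.range n, c i * b i := by
    apply Finset.sum_congr rfl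
    intro i hi
    exact II_eq k hk w A B t N _ hN0 ht0 (hpos i (Finset.mem_range.mp hi))
  rw [hsumeq] at h1
  obtain ⟨hc1, hc2⟩ := hst t ht0
  have hKt : C2 / √t ≤ K / √t := by
    gcongr
    rw [hK]
    nlinarith
  have h2 := abel_bd b c n R (K / √t) hR (by positivity) hpre (fun i hi => (hc1 _ (hXin i hi)).trans hKt) (by
    calc _ ≤ ∑ i ∈ Finset.range (n - 1), C2 / √t * (X (i + 1) - X i) := by
          apply Finset.sum_le_sum
          intro i hi
          rw [Finset.mem_range] at hi
          have := hc2 _ (hXin i (by omega)) _ (hXin (i + 1) (by omega))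
          rw [abs_of_nonneg (by linarith [hXmono i])] at this
          exact this
      _ = C2 / √t * (X (n - 1) - X 0) := by
          rw [← Finset.mul_sum, Finset.sum_range_sub]
      _ ≤ C2 / √t * (1 + (x2 - x1)) := by
          gcongr
          rcases Nat.eq_zero_or_pos n with h0 | h0
          · subst h0; simp; linarith
          · have e1 := hXin (n - 1) (by omega)
            have e2 := hXin 0 (by omega)
            linarith [e1.2, e2.1]
      _ = K / √t := by rw [hK]; ring)
  refine h1.trans ?_
  have h3 : 0 ≤ C1 * (N / √t) * R := by positivity
  calc C1 + N * ‖∑ i ∈ Finset.range n, c i * b i‖ ≤ C1 + N * (2 * (K / √t) * R) := by gcongr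
    _ = C1 + 2 * K * (N / √t) * R := by ring
    _ ≤ _ := by nlinarith


lemma dyadic_piece (b : ℕ → ℂ) (n β j : ℕ) (hβ : β ≤ n) :
    ‖(∑ i ∈ Finset.range (β / 2 ^ j * 2 ^ j), b i) - ∑ i ∈ Finset.range (β / 2 ^ (j + 1) * 2 ^ (j + 1)), b i‖ ^ 4
      ≤ ∑ l ∈ Finset.range n, ‖∑ i ∈ (Finset.range n).filter (fun i => i / 2 ^ j = l), b i‖ ^ 4 := by
  have hnn : 0 ≤ ∑ l ∈ Finset.range n, ‖∑ i ∈ (Finset.range n).filter (fun i => i / 2 ^ j = l), b i‖ ^ 4 :=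
    Finset.sum_nonneg (fun l _ => by positivity)
  set e := β / 2 ^ j with he
  have h1 : β / 2 ^ (j + 1) = e / 2 := by rw [pow_succ, ← Nat.div_div_eq_div_mul]
  have hp : 0 < 2 ^ j := by positivity
  have heβ : e * 2 ^ j ≤ β := Nat.div_mul_le_self _ _
  rw [h1]
  rcases Nat.even_or_odd' e with ⟨c, hc | hc⟩
  · have : e / 2 * 2 ^ (j + 1) = e * 2 ^ j := by
      rw [hc, Nat.mul_div_cancel_left _ (by norm_num), pow_succ]; ring
    rw [this, sub_self, norm_zero]
    simpa using hnn
  · have h2 : e / 2 * 2 ^ (j + 1) = (2 * c) * 2 ^ j := by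
      rw [hc, show (2 * c + 1) / 2 = c by omega, pow_succ]; ring
    rw [h2]
    have h3 : (2 * c) * 2 ^ j ≤ e * 2 ^ j := Nat.mul_le_mul_right _ (by omega)
    rw [← Finset.sum_Ico_eq_sub _ h3]
    have h4 : Finset.Ico ((2 * c) * 2 ^ j) (e * 2 ^ j) = (Finset.range n).filter (fun i => i / 2 ^ j = 2 * c) := by
      ext i
      rw [Finset.mem_Ico, Finset.mem_filter, Finset.mem_range, Nat.div_eq_iff hp, hc]
      rw [hc] at heβ
      constructor
      · rintro ⟨a1, a2⟩
        refine ⟨by omega, ?_, ?_⟩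
        · omega
        · have : (2 * c + 1) * 2 ^ j = 2 * c * 2 ^ j + 2 ^ j := by ring
          omega
      · rintro ⟨a0, a1, a2⟩
        have : (2 * c + 1) * 2 ^ j = 2 * c * 2 ^ j + 2 ^ j := by ring
        omega
    rw [h4]
    refine Finset.single_le_sum (f := fun l => ‖∑ i ∈ (Finset.range n).filter (fun i => i / 2 ^ j = l), b i‖ ^ 4) 
      (fun l _ => by positivity) (Finset.mem_range.mpr ?_)
    have : e ≤ e * 2 ^ j := Nat.le_mul_of_pos_right _ hp
    omega

lemma dyadic_max (b : ℕ → ℂ) (n K β : ℕ) (hn : n ≤ 2 ^ K) (hβ : β ≤ n) :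
    ‖∑ i ∈ Finset.range β, b i‖ ^ 4 ≤ ((K : ℝ) + 1) ^ 3 * ∑ j ∈ Finset.range (K + 1),
      ∑ l ∈ Finset.range n, ‖∑ i ∈ (Finset.range n).filter (fun i => i / 2 ^ j = l), b i‖ ^ 4 := by
  set P : ℕ → ℂ := fun j => ∑ i ∈ Finset.range (β / 2 ^ j * 2 ^ j), b i with hP
  have h0 : P 0 = ∑ i ∈ Finset.range β, b i := by simp [hP]
  have hK : P (K + 1) = 0 := by
    have : β / 2 ^ (K + 1) = 0 := by
      apply Nat.div_eq_of_lt
      rw [pow_succ]; have : 0 < 2 ^ K := by positivity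
      omega
    simp [hP, this]
  have htel : ∑ i ∈ Finset.range β, b i = ∑ j ∈ Finset.range (K + 1), (P j - P (j + 1)) := by
    rw [Finset.sum_range_sub', h0, hK, sub_zero]
  rw [htel]
  have h1 := pow_sum_div_card_le_sum_pow (s := Finset.range (K + 1)) (f := fun j => ‖P j - P (j + 1)‖) (fun j _ => norm_nonneg _) 3
  rw [Finset.card_range, div_le_iff₀ (by positivity)] at h1
  calc _ ≤ (∑ j ∈ Finset.range (K + 1), ‖P j - P (j + 1)‖) ^ 4 := by
        gcongr; exact norm_sum_le _ _
    _ ≤ (∑ j ∈ Finset.range (K + 1), ‖P j - P (j + 1)‖ ^ 4) * ((K + 1 : ℕ) : ℝ) ^ 3 := h1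
    _ ≤ _ := by
        rw [mul_comm]; push_cast
        gcongr with j hj
        exact dyadic_piece b n β j hβ

lemma sum_cnt_fiber (J L : Finset ℕ) (g : ℕ → ℕ) (ν : ℕ → ℝ) (γ : ℝ) :
    ∑ l ∈ L, cnt (J.filter (fun m => g m = l)) ν γ ≤ cnt J ν γ := by
  classical
  unfold cnt
  rw [← Finset.card_biUnion]
  · apply Finset.card_le_card
    intro p hp
    rw [Finset.mem_biUnion] at hp
    obtain ⟨l, hl, hp⟩ := hp
    simp only [Finset.mem_filter, Finset.mem_product] at hp ⊢
    tauto
  · intro l1 _ l2 _ hne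
    refine Finset.disjoint_left.mpr ?_
    intro p h1 h2
    simp only [Finset.mem_filter, Finset.mem_product] at h1 h2
    exact hne (h1.1.1.1.2.symm.trans h2.1.1.1.2)

lemma card_le_of_diff (s : Finset ℕ) (D : ℝ) (hD : 0 ≤ D) (h : ∀ a ∈ s, ∀ b ∈ s, (b : ℝ) - a ≤ D) :
    (s.card : ℝ) ≤ D + 1 := by
  rcases s.eq_empty_or_nonempty with h0 | h0
  · subst h0; simp; linarith
  · have hsub : s ⊆ Finset.Icc (s.min' h0) (s.min' h0 + ⌊D⌋₊) := by
      intro b hb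
      rw [Finset.mem_Icc]
      refine ⟨Finset.min'_le _ _ hb, ?_⟩
      have h1 := h _ (Finset.min'_mem s h0) b hb
      have h2 := Finset.min'_le s b hb
      have : b - s.min' h0 ≤ ⌊D⌋₊ := by
        apply Nat.le_floor
        rw [Nat.cast_sub h2]; exact h1
      omega
    have h3 := Finset.card_le_card hsub
    rw [Nat.card_Icc] at h3
    have h4 : s.card ≤ ⌊D⌋₊ + 1 := by omega
    calc (s.card : ℝ) ≤ ((⌊D⌋₊ + 1 : ℕ) : ℝ) := by exact_mod_cast h4
      _ ≤ D + 1 := by push_cast; linarith [Nat.floor_le hD]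

lemma card_range_le (s : Finset ℕ) (A B N : ℝ) (hA : 0 < A) (hAB : A < B) (hN : 1 ≤ N)
    (hs : ∀ n ∈ s, A * N ≤ n ∧ n ≤ B * N) : (s.card : ℝ) ≤ (B + 1) * N := by
  have := card_le_of_diff s (B * N) (by nlinarith) (by
    intro a ha b hb
    have := (hs b hb).2
    have : (0:ℝ) ≤ a := Nat.cast_nonneg _
    linarith)
  linarith

lemma rpow_diff (k a b : ℝ) (hk : 1 < k) (ha : 0 < a) (hab : a ≤ b) : k * a ^ (k - 1) * (b - a) ≤ b ^ k - a ^ k := by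
  have h1 := one_add_mul_self_le_rpow_one_add (s := (b - a) / a) (by
    have : 0 ≤ (b - a) / a := div_nonneg (by linarith) ha.le
    linarith) hk.le
  have h2 : 1 + (b - a) / a = b / a := by field_simp; ring
  rw [h2, Real.div_rpow (by linarith) ha.le, le_div_iff₀ (Real.rpow_pos_of_pos ha k)] at h1
  have h3 : a ^ k = a ^ (k - 1) * a := by rw [← Real.rpow_add_one ha.ne']; congr 1; ring
  have h4 : (1 + k * ((b - a) / a)) * a ^ k = a ^ k + k * a ^ (k - 1) * (b - a) := by
    rw [h3]; field_simp
  linarith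

lemma trivial_count (k A B Γ : ℝ) (hk : 1 < k) (hA : 0 < A) (hAB : A < B) (hΓ : 0 < Γ) :
    ∃ C ≥ 0, ∀ N ≥ (1:ℝ), ∀ s : Finset ℕ, (∀ n ∈ s, A * N ≤ n ∧ n ≤ B * N) → 
      (cnt s (fun n => (n:ℝ) ^ k) (Γ * N ^ (k - 1)) : ℝ) ≤ C * N ^ 3 := by
  classical
  set D := 2 * Γ / (k * A ^ (k - 1)) with hD
  have hA' : 0 < A ^ (k - 1) := Real.rpow_pos_of_pos hA _
  have hD0 : 0 < D := by positivity
  have hB : 0 < B := by linarith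
  refine ⟨(⌊D + 1⌋₊ : ℝ) * (B + 1) ^ 3, by positivity, ?_⟩
  intro N hN s hs
  have hcard := card_range_le s A B N hA hAB hN hs
  have hN0 : 0 < N := by linarith
  set f : (ℕ × ℕ) × (ℕ × ℕ) → (ℕ × ℕ) × ℕ := fun p => (p.1, p.2.1) with hf
  unfold cnt
  set Q := ((s ×ˢ s) ×ˢ (s ×ˢ s)).filter (fun p : (ℕ × ℕ) × (ℕ × ℕ) => 
    |((p.1.1 : ℝ) ^ k + (p.1.2 : ℝ) ^ k) - ((p.2.1 : ℝ) ^ k + (p.2.2 : ℝ) ^ k)| ≤ Γ * N ^ (k - 1)) with hQ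
  have h1 := Finset.card_le_mul_card_image (f := f) Q ⌊D + 1⌋₊ (by
    intro y hy
    have hinj : (Q.filter (fun p => f p = y)).card = ((Q.filter (fun p => f p = y)).image (fun p => p.2.2)).card := by
      rw [Finset.card_image_of_injOn]
      intro p hp q hq hpq
      simp only [Finset.coe_filter, Set.mem_setOf_eq, hf] at hp hq hpq
      have := hp.2.trans hq.2.symm
      simp only [Prod.mk.injEq] at this
      ext <;> simp_all
    apply Nat.le_floor
    rw [hinj]
    apply card_le_of_diff _ _ hD0.le
    intro a ha b hb
    rw [Finset.mem_image] at ha hb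
    obtain ⟨p, hp, rfl⟩ := ha
    obtain ⟨q, hq, rfl⟩ := hb
    rw [Finset.mem_filter] at hp hq
    have hfe := hp.2.trans hq.2.symm
    simp only [hf, Prod.mk.injEq] at hfe
    obtain ⟨hp1, _⟩ := hp
    obtain ⟨hq1, _⟩ := hq
    rw [hQ, Finset.mem_filter] at hp1 hq1
    have e1 := hp1.2
    have e2 := hq1.2
    rw [← hfe.1, ← hfe.2] at e2
    simp only [Finset.mem_product] at hp1 hq1
    have r1 := (hs _ hp1.1.2.2).1
    rcases le_total q.2.2 p.2.2 with hle | hle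
    · have : (q.2.2 : ℝ) ≤ p.2.2 := by exact_mod_cast hle
      linarith
    · have hle' : (p.2.2 : ℝ) ≤ q.2.2 := by exact_mod_cast hle
      have hd := rpow_diff k p.2.2 q.2.2 hk (lt_of_lt_of_le (by positivity) r1) hle'
      have hpow : (A * N) ^ (k - 1) ≤ (p.2.2 : ℝ) ^ (k - 1) := Real.rpow_le_rpow (by positivity) r1 (by linarith)
      rw [Real.mul_rpow hA.le hN0.le] at hpow
      rw [abs_le] at e1 e2
      have h5 : (q.2.2 : ℝ) ^ k - (p.2.2 : ℝ) ^ k ≤ 2 * Γ * N ^ (k - 1) := by linarith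
      have h6 : k * (A ^ (k - 1) * N ^ (k - 1)) * ((q.2.2 : ℝ) - p.2.2) ≤ k * (p.2.2 : ℝ) ^ (k - 1) * ((q.2.2 : ℝ) - p.2.2) := by
        have : 0 ≤ (q.2.2 : ℝ) - p.2.2 := by linarith
        gcongr
      have hNk : 0 < N ^ (k - 1) := Real.rpow_pos_of_pos hN0 _
      rw [hD, le_div_iff₀ (by positivity)]
      have h7 : (((q.2.2 : ℝ) - p.2.2) * (k * A ^ (k - 1))) * N ^ (k - 1) ≤ (2 * Γ) * N ^ (k - 1) := by linarith
      exact le_of_mul_le_mul_right h7 hNk)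
  have h2 : (Q.image f).card ≤ s.card * s.card * s.card := by
    rw [← Finset.card_product, ← Finset.card_product]
    apply Finset.card_le_card
    intro y hy
    rw [Finset.mem_image] at hy
    obtain ⟨p, hp, rfl⟩ := hy
    rw [hQ, Finset.mem_filter] at hp
    simp only [Finset.mem_product] at hp ⊢
    exact ⟨hp.1.1, hp.1.2.1⟩
  calc (Q.card : ℝ) ≤ ((⌊D + 1⌋₊ * (s.card * s.card * s.card) : ℕ) : ℝ) := by
        exact_mod_cast h1.trans (Nat.mul_le_mul_left _ h2)
    _ = ⌊D + 1⌋₊ * (s.card : ℝ) ^ 3 := by push_cast; ring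
    _ ≤ ⌊D + 1⌋₊ * ((B + 1) * N) ^ 3 := by gcongr
    _ = _ := by ring


lemma phi_deriv (k N t : ℝ) (hk : 1 < k) (ht : 0 < t) :
    HasDerivAt (fun t => phi k N t) ((N / k) ^ (k / (k - 1)) * t ^ (-(k / (k - 1)))) t := by
  have hk1 : 0 < k - 1 := by linarith
  unfold phi
  have h := ((Real.hasDerivAt_rpow_const (x := t) (p := 1 - k / (k - 1)) (Or.inl ht.ne')).const_mul
    ((k - 1) * (N / k) ^ (k / (k - 1)))).neg
  refine HasDerivAt.congr_deriv h ?_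
  rw [show 1 - k / (k - 1) - 1 = -(k / (k - 1)) by ring]
  have : (k - 1) * (1 - k / (k - 1)) = -1 := by field_simp; ring
  linear_combination (-(N / k) ^ (k / (k - 1)) * t ^ (-(k / (k - 1)))) * this

lemma phi_cont (k N T : ℝ) (hT : 0 < T) : ContinuousOn (fun t => phi k N t) (Set.uIcc T (2 * T)) := by
  unfold phi
  rw [Set.uIcc_of_le (by linarith)]
  refine ContinuousOn.neg (ContinuousOn.mul continuousOn_const ?_)
  exact ContinuousOn.rpow_const continuousOn_id (fun t ht => Or.inl (show t ≠ 0 from (show (0:ℝ) < t by linarith [ht.1]).ne'))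

lemma cell_int (k : ℝ) (hk : 1 < k) (N T : ℝ) (hN : 0 < N) (hT : 0 < T) (J : Finset ℕ) :
    ∫ t in T..(2 * T), ‖∑ m ∈ J, ee (phi k N t * (m : ℝ) ^ (k / (k - 1)))‖ ^ 4 ≤
      ((k - 1) * 2 ^ (k / (k - 1)) * C0) * T * cnt J (fun m => (m : ℝ) ^ (k / (k - 1)))
        (k ^ (k / (k - 1)) / (k - 1) * (T ^ (k / (k - 1) - 1) / N ^ (k / (k - 1)))) := by
  have hk0 : 0 < k := by linarith
  have hk1 : 0 < k - 1 := by linarith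
  set k' := k / (k - 1) with hk'
  have hk'1 : 1 < k' := by rw [hk', lt_div_iff₀ hk1]; linarith
  set F : ℝ → ℝ := fun u => ‖∑ m ∈ J, (1 : ℂ) * ee (u * (m : ℝ) ^ k')‖ ^ 4 with hF
  have hFc : Continuous F := by
    rw [hF]
    refine Continuous.pow (Continuous.norm (continuous_finsetSum _ fun m _ => ?_)) 4
    exact continuous_const.mul (ee_comp_continuous (by fun_prop))
  have hF0 : ∀ u, 0 ≤ F u := fun u => by simp only [hF]; positivity
  have hle : T ≤ 2 * T := by linarith
  set L := (k - 1) * (N / k) ^ k' * T ^ (1 - k') with hL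
  have hL0 : 0 < L := by positivity
  set δ := (N / k) ^ k' * (2 * T) ^ (-k') with hδ
  have hδ0 : 0 < δ := by positivity
  have hphi1 : phi k N T = -L := rfl
  have hphi2 : phi k N (2 * T) ≤ 0 := by
    unfold phi; rw [neg_nonpos]; positivity
  have hphi12 : phi k N T ≤ phi k N (2 * T) := by
    unfold phi
    rw [neg_le_neg_iff]
    refine mul_le_mul_of_nonneg_left ?_ (by positivity)
    exact Real.rpow_le_rpow_of_nonpos hT hle (by linarith)
  have hup := fourth_upper J (fun _ => (1:ℂ)) (fun _ => by simp) (fun m => (m : ℝ) ^ k') L (phi k N T) (phi k N (2 * T))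
    hL0 hphi1.ge (hphi2.trans hL0.le) hphi12
  have hc2 : ContinuousOn (fun t : ℝ => (N / k) ^ k' * t ^ (-k')) (Set.uIcc T (2 * T)) := by
    rw [Set.uIcc_of_le hle]
    refine ContinuousOn.mul continuousOn_const ?_
    exact ContinuousOn.rpow_const continuousOn_id (fun t ht => Or.inl (show t ≠ 0 from (show (0:ℝ) < t by linarith [ht.1]).ne'))
  have hsub := intervalIntegral.integral_comp_mul_deriv (a := T) (b := 2 * T) (f := fun t => phi k N t) (g := F)
    (f' := fun t => (N / k) ^ k' * t ^ (-k'))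
    (fun t ht => phi_deriv k N t hk (by rw [Set.uIcc_of_le hle] at ht; linarith [ht.1])) hc2 hFc
  have hFphi : ContinuousOn (fun t => F (phi k N t)) (Set.uIcc T (2 * T)) :=
    hFc.comp_continuousOn (phi_cont k N T hT)
  have hmain : δ * ∫ t in T..(2 * T), F (phi k N t) ≤ ∫ u in (phi k N T)..(phi k N (2 * T)), F u := by
    rw [← hsub, ← intervalIntegral.integral_const_mul]
    refine intervalIntegral.integral_mono_on hle ?_ ?_ ?_
    · exact (continuousOn_const.mul hFphi).intervalIntegrable
    · exact (hFphi.mul hc2).intervalIntegrable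
    · intro t ht
      have ht0 : 0 < t := by linarith [ht.1]
      simp only [Function.comp]
      rw [mul_comm]
      refine mul_le_mul_of_nonneg_left ?_ (hF0 _)
      rw [hδ]
      refine mul_le_mul_of_nonneg_left ?_ (by positivity)
      exact Real.rpow_le_rpow_of_nonpos ht0 ht.2 (by linarith)
  have hLδ : L = δ * ((k - 1) * 2 ^ k' * T) := by
    rw [hL, hδ, Real.mul_rpow (by norm_num) hT.le, Real.rpow_neg (by norm_num), Real.rpow_sub hT, Real.rpow_neg hT.le,
      Real.rpow_one]
    field_simp
  have hLinv : 1 / L = k ^ k' / (k - 1) * (T ^ (k' - 1) / N ^ k') := by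
    rw [hL, Real.div_rpow hN.le hk0.le, Real.rpow_sub hT, Real.rpow_sub hT, Real.rpow_one]
    field_simp
  rw [← hLinv]
  have heq : ∫ t in T..(2 * T), ‖∑ m ∈ J, ee (phi k N t * (m : ℝ) ^ k')‖ ^ 4 = ∫ t in T..(2 * T), F (phi k N t) := by
    simp only [hF, one_mul]
  rw [heq]
  have h3 : δ * ∫ t in T..(2 * T), F (phi k N t) ≤ C0 * L * cnt J (fun m => (m : ℝ) ^ k') (1 / L) := hmain.trans hup
  rw [← mul_le_mul_iff_right₀ hδ0]
  refine h3.trans (le_of_eq ?_)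
  nth_rw 1 [hLδ]
  ring

lemma log_pick (c η : ℝ) (hc : 3 ≤ c) (hη : 0 < η) :
    ∃ C ≥ 0, ∀ N ≥ (1:ℝ), ∃ K : ℕ, c * N ≤ 2 ^ K ∧ ((K:ℝ) + 1) ^ 4 ≤ C * N ^ η := by
  refine ⟨(4 / (η / 4)) ^ 4 * c ^ η, by positivity, fun N hN => ?_⟩
  have hcN : 3 ≤ c * N := by nlinarith
  set x := Real.log (c * N) with hx
  have hx1 : 1 ≤ x := by
    rw [hx, Real.le_log_iff_exp_le (by linarith)]
    linarith [Real.exp_one_lt_d9]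
  refine ⟨⌈2 * x⌉₊, ?_, ?_⟩
  · have h1 : 2 * x ≤ (⌈2 * x⌉₊ : ℝ) := Nat.le_ceil _
    rw [← Real.rpow_natCast, ← Real.exp_log (show 0 < c * N by linarith), Real.rpow_def_of_pos (by norm_num)]
    rw [Real.exp_le_exp, ← hx]
    have := Real.log_two_gt_d9
    nlinarith
  · have h1 : (⌈2 * x⌉₊ : ℝ) < 2 * x + 1 := Nat.ceil_lt_add_one (by linarith)
    have h2 : x ≤ (c * N) ^ (η / 4) / (η / 4) := Real.log_le_rpow_div (by linarith) (by linarith)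
    have h3 : (⌈2 * x⌉₊ : ℝ) + 1 ≤ 4 / (η / 4) * (c * N) ^ (η / 4) := by
      calc _ ≤ 4 * x := by linarith
        _ ≤ 4 * ((c * N) ^ (η / 4) / (η / 4)) := by linarith
        _ = _ := by ring
    calc _ ≤ (4 / (η / 4) * (c * N) ^ (η / 4)) ^ 4 := by gcongr
      _ = _ := by
        rw [mul_pow, ← Real.rpow_natCast, ← Real.rpow_natCast ((c * N) ^ (η / 4)), ← Real.rpow_mul (by linarith), 
          show η / 4 * ((4:ℕ):ℝ) = η by push_cast; ring, Real.mul_rpow (by linarith) (by linarith)]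
        ring

lemma reindex (f : ℕ → ℂ) (m1 n : ℕ) (g : ℕ → ℕ) (l : ℕ) :
    ∑ i ∈ (Finset.range n).filter (fun i => g i = l), f (m1 + i) = 
    ∑ m ∈ (Finset.Ico m1 (m1 + n)).filter (fun m => g (m - m1) = l), f m := by
  rw [Finset.sum_filter, Finset.sum_filter, Finset.sum_Ico_eq_sum_range]
  simp



def HH (b : ℝ) : Prop := ∀ k > (1:ℝ), ∀ A B : ℝ, 0 < A → A < B → ∀ Γ > (0:ℝ), ∃ C ≥ (0:ℝ), ∀ N ≥ (1:ℝ), ∀ s : Finset ℕ,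
  (∀ n ∈ s, A * N ≤ n ∧ n ≤ B * N) → (cnt s (fun n => (n:ℝ) ^ k) (Γ * N ^ (k - 2)) : ℝ) ≤ C * N ^ (2 + b)

lemma block (b : ℝ) (hb : 0 ≤ b) (hH : HH b) (k : ℝ) (hk : 1 < k) {A B : ℝ} {w w1 w2 : ℝ → ℝ} (hW : Wt A B w w1 w2)
    (hA : 0 < A) (hAB : A < B) (η : ℝ) (hη : 0 < η) :
    ∃ C ≥ 0, ∀ N ≥ (1:ℝ), ∀ M, 1 ≤ M → M ≤ N → ∀ s : Finset ℕ, (∀ n : ℕ, A * N < n → n < B * N → n ∈ s) →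
      ∫ t in (N * M)..(2 * (N * M)), ‖∑ n ∈ s, (w (n / N) : ℂ) * ee (t * (n / N) ^ k)‖ ^ 4 ≤ C * N ^ (3 + η) * M ^ (1 + b) := by
  have hk0 : 0 < k := by linarith
  have hk1 : 0 < k - 1 := by linarith
  have hB : 0 < B := hA.trans hAB
  obtain ⟨al, hal0, hal⟩ : ∃ al, 0 < al ∧ al < A ^ (k - 1) := 
    ⟨A ^ (k - 1) / 2, by positivity, by have : 0 < A ^ (k - 1) := by positivity
                                        linarith⟩
  obtain ⟨be, hbe⟩ : ∃ be, B ^ (k - 1) < be := ⟨B ^ (k - 1) + 1, by linarith⟩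
  have hbe0 : 0 < be := lt_trans (Real.rpow_pos_of_pos (hA.trans hAB) _) hbe
  have halbe : al < be := by
    have : A ^ (k - 1) < B ^ (k - 1) := Real.rpow_lt_rpow hA.le hAB hk1
    linarith
  obtain ⟨C, hC, hbp⟩ := bproc k hk hW hA hAB al be hal0 hal hbe
  set k' := k / (k - 1) with hk'
  have hk'1 : 1 < k' := by rw [hk', lt_div_iff₀ hk1]; linarith
  set c3 := k ^ k' / (k - 1) with hc3
  have hc30 : 0 < c3 := by positivity
  obtain ⟨CH, hCH, hcnt⟩ := hH k' hk'1 (al * k) (be * (k * 2)) (by positivity) (by nlinarith [mul_pos hbe0 hk0, mul_pos hk0 (sub_pos.mpr halbe)]) c3 hc30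
  obtain ⟨CK, hCK, hlog⟩ := log_pick (be * (k * 2) + 3) η (by nlinarith [mul_pos hbe0 hk0]) hη
  set c5 := (k - 1) * 2 ^ k' * C0 with hc5
  have hc50 : 0 ≤ c5 := by have := C0_nonneg; positivity
  refine ⟨8 * C ^ 4 * (1 + CK * c5 * CH), by positivity, ?_⟩
  intro N hN M hM hMN s hs
  have hN0 : 0 < N := by linarith
  have hM0 : 0 < M := by linarith
  obtain ⟨K, hK1, hK2⟩ := hlog N hN
  set T := N * M with hT
  have hT0 : 0 < T := by positivity
  have hTN : N ≤ T := by nlinarith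
  have hTT : T ≤ 2 * T := by linarith
  set X1 := al * (k * M) with hX1
  set X2 := be * (k * (2 * M)) with hX2
  have hX2p : 0 ≤ X2 := by positivity
  have e1 : al * (k * T) = X1 * N := by rw [hX1, hT]; ring
  have e2 : be * (k * (2 * T)) = X2 * N := by rw [hX2, hT]; ring
  set m1 := ⌈X1⌉₊ with hm1
  set n := ⌊X2⌋₊ + 1 - m1 with hn
  have hI1 : ∀ m : ℕ, al * (k * T) ≤ m * N → m * N ≤ be * (k * (2 * T)) → m1 ≤ m ∧ m < m1 + n := by
    intro m h1 h2
    rw [e1] at h1; rw [e2] at h2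
    have h3 : X1 ≤ m := le_of_mul_le_mul_right h1 hN0
    have h4 : (m:ℝ) ≤ X2 := le_of_mul_le_mul_right h2 hN0
    have h5 : m1 ≤ m := Nat.ceil_le.mpr h3
    have h6 : m ≤ ⌊X2⌋₊ := Nat.le_floor h4
    omega
  have hI2' : ∀ m : ℕ, m1 ≤ m → m < m1 + n → X1 ≤ m ∧ (m:ℝ) ≤ X2 := by
    intro m h1 h2
    refine ⟨Nat.ceil_le.mp h1, ?_⟩
    have : m ≤ ⌊X2⌋₊ := by omega
    exact (Nat.le_floor_iff hX2p).mp this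
  have hI2 : ∀ i < n, al * (k * T) ≤ ((m1 + i : ℕ) : ℝ) * N ∧ ((m1 + i : ℕ) : ℝ) * N ≤ be * (k * (2 * T)) := by
    intro i hi
    obtain ⟨h1, h2⟩ := hI2' (m1 + i) (by omega) (by omega)
    rw [e1, e2]
    exact ⟨mul_le_mul_of_nonneg_right h1 hN0.le, mul_le_mul_of_nonneg_right h2 hN0.le⟩
  have hnK : n ≤ 2 ^ K := by
    have h1 : n ≤ ⌊X2⌋₊ + 1 := by omega
    have h2 : (⌊X2⌋₊ : ℝ) ≤ X2 := Nat.floor_le hX2p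
    have h3 : (n : ℝ) ≤ X2 + 1 := by
      have : (n:ℝ) ≤ (⌊X2⌋₊ : ℝ) + 1 := by exact_mod_cast h1
      linarith
    have h4 : X2 + 1 ≤ (be * (k * 2) + 3) * N := by
      have : X2 ≤ be * (k * 2) * N := by
        rw [hX2, show be * (k * (2 * M)) = be * (k * 2) * M by ring]
        exact mul_le_mul_of_nonneg_left hMN (by positivity)
      linarith
    have : (n:ℝ) ≤ 2 ^ K := by linarith
    exact_mod_cast this
  set J := Finset.Ico m1 (m1 + n) with hJ
  set cell : ℕ → ℕ → Finset ℕ := fun j l => J.filter (fun m => (m - m1) / 2 ^ j = l) with hcell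
  set G : Finset ℕ → ℝ → ℝ := fun c t => ‖∑ m ∈ c, ee (phi k N t * (m : ℝ) ^ k')‖ ^ 4 with hG
  have hGc : ∀ c, ContinuousOn (G c) (Set.uIcc T (2 * T)) := by
    intro c
    rw [hG]
    refine ContinuousOn.pow (ContinuousOn.norm (continuousOn_finsetSum _ fun m _ => ?_)) 4
    exact ee_continuous.comp_continuousOn ((phi_cont k N T hT0).mul continuousOn_const)
  set Q : ℝ → ℝ := fun t => ((K:ℝ) + 1) ^ 3 * ∑ j ∈ Finset.range (K + 1), ∑ l ∈ Finset.range n, G (cell j l) t with hQ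
  have hQ0 : ∀ t, 0 ≤ Q t := by
    intro t
    simp only [hQ, hG]; positivity
  have hQc : ContinuousOn Q (Set.uIcc T (2 * T)) := by
    rw [hQ]
    exact continuousOn_const.mul (continuousOn_finsetSum _ fun j _ => continuousOn_finsetSum _ fun l _ => hGc _)
  have hSc : Continuous (fun t : ℝ => ‖∑ n ∈ s, (w (n / N) : ℂ) * ee (t * (n / N) ^ k)‖ ^ 4) := by
    refine Continuous.pow (Continuous.norm (continuous_finsetSum _ fun m _ => ?_)) 4
    exact continuous_const.mul (ee_comp_continuous (by fun_prop))
  have hpt : ∀ t ∈ Set.Icc T (2 * T), ‖∑ n ∈ s, (w (n / N) : ℂ) * ee (t * (n / N) ^ k)‖ ^ 4 ≤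
      8 * C ^ 4 * (1 + N ^ 4 / T ^ 2 * Q t) := by
    intro t ht
    have ht0 : 0 < t := by linarith [ht.1]
    set R := √(√(Q t)) with hR
    have hR4 : R ^ 4 = Q t := by
      rw [hR, show (4:ℕ) = 2 * 2 by norm_num, pow_mul, Real.sq_sqrt (Real.sqrt_nonneg _), Real.sq_sqrt (hQ0 t)]
    have hpre : ∀ j ≤ n, ‖∑ i ∈ Finset.range j, ee (phi k N t * ((m1 + i : ℕ) : ℝ) ^ k')‖ ≤ R := by
      intro j hj
      have h1 := dyadic_max (fun i => ee (phi k N t * ((m1 + i : ℕ) : ℝ) ^ k')) n K j hnK hj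
      have h2 : ((K : ℝ) + 1) ^ 3 * ∑ j ∈ Finset.range (K + 1), ∑ l ∈ Finset.range n, 
          ‖∑ i ∈ (Finset.range n).filter (fun i => i / 2 ^ j = l), ee (phi k N t * ((m1 + i : ℕ) : ℝ) ^ k')‖ ^ 4 = Q t := by
        rw [hQ]
        simp only [hG, hcell, hJ]
        congr 1
        refine Finset.sum_congr rfl fun j _ => Finset.sum_congr rfl fun l _ => ?_
        rw [reindex (fun m => ee (phi k N t * ((m : ℕ) : ℝ) ^ k')) m1 n (fun i => i / 2 ^ j) l]
      rw [h2] at h1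
      refine le_of_pow_le_pow_left₀ (n := 4) (by norm_num) (by positivity) ?_
      rw [hR4]; exact h1
    have h := hbp N hN T hTN t ht s hs m1 n hI1 hI2 R (Real.sqrt_nonneg _) hpre
    have hst : 0 < √t := Real.sqrt_pos.mpr ht0
    have hs4 : √t ^ 4 = t ^ 2 := by
      rw [show (4:ℕ) = 2 * 2 by norm_num, pow_mul, Real.sq_sqrt ht0.le]
    calc _ ≤ (C + C * (N / √t) * R) ^ 4 := by gcongr
      _ ≤ 2 ^ (4 - 1) * (C ^ 4 + (C * (N / √t) * R) ^ 4) := add_pow_le hC (by positivity) 4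
      _ = 8 * C ^ 4 * (1 + N ^ 4 / t ^ 2 * Q t) := by
        rw [mul_pow, mul_pow, div_pow, hs4, hR4]; norm_num; ring
      _ ≤ _ := by
        have := hQ0 t
        have := ht.1
        gcongr
  have hcellint : ∀ c, ∫ t in T..(2 * T), G c t ≤ c5 * T * cnt c (fun m => (m : ℝ) ^ k') (c3 * (T ^ (k' - 1) / N ^ k')) :=
    fun c => cell_int k hk N T hN0 hT0 c
  set τ := c3 * (T ^ (k' - 1) / N ^ k') with hτ
  have hQint : ∫ t in T..(2 * T), Q t ≤ ((K:ℝ) + 1) ^ 4 * (c5 * T * cnt J (fun m => (m : ℝ) ^ k') τ) := by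
    rw [hQ, intervalIntegral.integral_const_mul, intervalIntegral.integral_finset_sum (fun j _ => 
      (continuousOn_finsetSum _ fun l _ => hGc _).intervalIntegrable)]
    have h1 : ∀ j ∈ Finset.range (K + 1), ∫ t in T..(2 * T), ∑ l ∈ Finset.range n, G (cell j l) t ≤ 
        c5 * T * cnt J (fun m => (m : ℝ) ^ k') τ := by
      intro j _
      rw [intervalIntegral.integral_finset_sum (fun l _ => (hGc _).intervalIntegrable)]
      calc _ ≤ ∑ l ∈ Finset.range n, c5 * T * cnt (cell j l) (fun m => (m : ℝ) ^ k') τ := 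
            Finset.sum_le_sum fun l _ => hcellint _
        _ = c5 * T * ∑ l ∈ Finset.range n, (cnt (cell j l) (fun m => (m : ℝ) ^ k') τ : ℝ) := by rw [Finset.mul_sum]
        _ ≤ _ := by
          refine mul_le_mul_of_nonneg_left ?_ (by positivity)
          exact_mod_cast sum_cnt_fiber J (Finset.range n) (fun m => (m - m1) / 2 ^ j) (fun m => (m : ℝ) ^ k') τ
    have h2 := Finset.sum_le_sum h1
    rw [Finset.sum_const, Finset.card_range, nsmul_eq_mul] at h2
    calc _ ≤ ((K:ℝ) + 1) ^ 3 * (((K + 1 : ℕ) : ℝ) * (c5 * T * cnt J (fun m => (m : ℝ) ^ k') τ)) := by gcongr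
      _ = _ := by push_cast; ring
  have hτle : τ ≤ c3 * M ^ (k' - 2) := by
    rw [hτ]
    refine mul_le_mul_of_nonneg_left ?_ hc30.le
    have : T ^ (k' - 1) / N ^ k' = M ^ (k' - 1) / N := by
      rw [hT, Real.mul_rpow hN0.le hM0.le, Real.rpow_sub hN0, Real.rpow_one]
      field_simp
    rw [this, show k' - 2 = (k' - 1) - 1 by ring, Real.rpow_sub hM0 (k' - 1) 1, Real.rpow_one]
    gcongr
  have hcJ : (cnt J (fun m => (m : ℝ) ^ k') τ : ℝ) ≤ CH * M ^ (2 + b) := by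
    refine le_trans ?_ (hcnt M hM J ?_)
    · exact_mod_cast cnt_mono (Finset.Subset.refl J) _ hτle
    · intro m hm
      rw [hJ, Finset.mem_Ico] at hm
      obtain ⟨h1, h2⟩ := hI2' m hm.1 hm.2
      constructor
      · rw [hX1] at h1; linarith
      · rw [hX2] at h2; linarith
  calc _ ≤ ∫ t in T..(2 * T), 8 * C ^ 4 * (1 + N ^ 4 / T ^ 2 * Q t) := by
        refine intervalIntegral.integral_mono_on hTT hSc.continuousOn.intervalIntegrable ?_ hpt
        exact (continuousOn_const.mul (continuousOn_const.add (continuousOn_const.mul hQc))).intervalIntegrable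
    _ = 8 * C ^ 4 * (T + N ^ 4 / T ^ 2 * ∫ t in T..(2 * T), Q t) := by
        have hi : IntervalIntegrable (fun t => N ^ 4 / T ^ 2 * Q t) MeasureTheory.volume T (2 * T) :=
          (continuousOn_const.mul hQc).intervalIntegrable
        rw [intervalIntegral.integral_const_mul, intervalIntegral.integral_add (by simp) hi,
          intervalIntegral.integral_const_mul]
        congr 2
        simp; ring
    _ ≤ 8 * C ^ 4 * (T + N ^ 4 / T ^ 2 * (CK * N ^ η * (c5 * T * (CH * M ^ (2 + b))))) := by
        have : ∫ t in T..(2 * T), Q t ≤ CK * N ^ η * (c5 * T * (CH * M ^ (2 + b))) := by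
          refine hQint.trans ?_
          gcongr
        gcongr
    _ = 8 * C ^ 4 * (T + CK * c5 * CH * (N ^ (3 + η) * M ^ (1 + b))) := by
        have h1 : N ^ (3 + η) = N ^ 3 * N ^ η := by
          rw [Real.rpow_add hN0]; norm_cast
        have h2 : M ^ (2 + b) = M * M ^ (1 + b) := by
          rw [show 2 + b = 1 + (1 + b) by ring, Real.rpow_add hM0 1, Real.rpow_one]
        rw [h1, h2, hT]
        field_simp
    _ ≤ 8 * C ^ 4 * (N ^ (3 + η) * M ^ (1 + b) + CK * c5 * CH * (N ^ (3 + η) * M ^ (1 + b))) := by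
        have h1 : N ≤ N ^ (3 + η) := by
          nth_rw 1 [← Real.rpow_one N]
          exact Real.rpow_le_rpow_of_exponent_le hN (by linarith)
        have h2 : M ≤ M ^ (1 + b) := by
          nth_rw 1 [← Real.rpow_one M]
          exact Real.rpow_le_rpow_of_exponent_le hM (by linarith)
        rw [hT]
        gcongr
    _ = _ := by ring


lemma weight_exists (A B : ℝ) (hA : 0 < A) (hAB : A < B) : ∃ w w1 w2 : ℝ → ℝ, Wt (A / 2) (2 * B) w w1 w2 ∧
    (∀ z, 0 ≤ w z) ∧ (∀ z, w z ≤ 1) ∧ ∀ z ∈ Set.Icc A B, w z = 1 := by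
  let f : ContDiffBump ((A + B) / 2 : ℝ) := ⟨(B - A) / 2, (B - A) / 2 + A / 4, by linarith, by linarith⟩
  have hf1 : ContDiff ℝ 2 (fun z => f z) := f.contDiff
  have hd1 : Differentiable ℝ (fun z => f z) := hf1.differentiable (by norm_num)
  have hf2 : ContDiff ℝ 1 (deriv (fun z => f z)) := by
    have : ContDiff ℝ (1 + 1) (fun z => f z) := by
      rw [show (1 + 1 : WithTop ℕ∞) = 2 by norm_num]; exact hf1
    exact (contDiff_succ_iff_deriv.mp this).2.2
  have hd2 : Differentiable ℝ (deriv (fun z => f z)) := hf2.differentiable (by norm_num)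
  have hout : ∀ z, z ∉ Set.Ioo (A / 2) (2 * B) → z ∉ tsupport (fun z => f z) := by
    intro z hz h
    have h2 : tsupport (fun z => f z) = Metric.closedBall ((A + B) / 2) ((B - A) / 2 + A / 4) := f.tsupport_eq
    rw [h2, Metric.mem_closedBall, Real.dist_eq, abs_le] at h
    exact hz ⟨by linarith, by linarith⟩
  refine ⟨fun z => f z, deriv (fun z => f z), deriv (deriv (fun z => f z)), ⟨?_, ?_, ?_, ?_, ?_⟩, ?_, ?_, ?_⟩
  · exact fun z => (hd1 z).hasDerivAt
  · exact fun z => (hd2 z).hasDerivAt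
  · exact hf2.continuous_deriv (by norm_num)
  · exact fun z hz => image_eq_zero_of_notMem_tsupport (hout z hz)
  · intro z hz
    by_contra h
    exact hout z hz (support_deriv_subset h)
  · exact fun z => f.nonneg
  · exact fun z => f.le_one
  · intro z hz
    refine f.one_of_mem_closedBall ?_
    change z ∈ Metric.closedBall ((A + B) / 2) ((B - A) / 2)
    rw [Metric.mem_closedBall, Real.dist_eq, abs_le]
    exact ⟨by linarith [hz.1], by linarith [hz.2]⟩

lemma HH_two : HH 2 := by
  intro k hk A B hA hAB Γ hΓ
  refine ⟨(B + 1) ^ 4, by have : 0 < B := hA.trans hAB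
                          positivity, fun N hN s hs => ?_⟩
  have h1 := card_range_le s A B N hA hAB hN hs
  have h2 : cnt s (fun n => (n:ℝ) ^ k) (Γ * N ^ (k - 2)) ≤ s.card ^ 4 := by
    unfold cnt
    refine (Finset.card_filter_le _ _).trans ?_
    rw [Finset.card_product, Finset.card_product]
    apply le_of_eq; ring
  calc _ ≤ (s.card : ℝ) ^ 4 := by exact_mod_cast h2
    _ ≤ ((B + 1) * N) ^ 4 := by gcongr
    _ = _ := by rw [mul_pow, show (2 + 2 : ℝ) = ((4:ℕ):ℝ) by norm_num, Real.rpow_natCast]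

lemma HH_step (b : ℝ) (hb : 0 ≤ b) (hH : HH b) (η : ℝ) (hη : 0 < η) : HH (b / (1 + b) + η) := by
  intro k hk A B hA hAB Γ hΓ
  have hB : 0 < B := hA.trans hAB
  have hk0 : 0 < k := by linarith
  obtain ⟨w, w1, w2, hW, hw0, hw1, hwe⟩ := weight_exists A B hA hAB
  obtain ⟨C1, hC1, hbl⟩ := block b hb hH k hk hW (by positivity) (by linarith) η hη
  obtain ⟨C2, hC2, htr⟩ := trivial_count k (A / 2) (2 * B) 1 hk (by positivity) (by linarith) one_pos
  have hC00 := C0_nonneg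
  refine ⟨(16 * Γ + 5) * (8 * (C0 * C2 + C1)), by positivity, ?_⟩
  intro N hN s0 hs0
  have hN0 : 0 < N := by linarith
  set s := (Finset.range (⌈2 * B * N⌉₊ + 1)).filter (fun n : ℕ => A / 2 * N ≤ n ∧ (n:ℝ) ≤ 2 * B * N) with hs
  have hmem : ∀ n : ℕ, n ∈ s ↔ A / 2 * N ≤ n ∧ (n:ℝ) ≤ 2 * B * N := by
    intro n
    rw [hs, Finset.mem_filter, Finset.mem_range, and_iff_right_iff_imp]
    rintro ⟨_, h⟩
    have h2 : (n:ℝ) ≤ (⌈2 * B * N⌉₊ : ℝ) := h.trans (Nat.le_ceil _)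
    have : n ≤ ⌈2 * B * N⌉₊ := by exact_mod_cast h2
    omega
  have hss : s0 ⊆ s := by
    intro n hn
    obtain ⟨h1, h2⟩ := hs0 n hn
    rw [hmem]
    constructor <;> nlinarith [mul_pos hA hN0, mul_pos hB hN0]
  set ν : ℕ → ℝ := fun n => ((n:ℝ) / N) ^ k with hν
  set F : ℝ → ℝ := fun t => ‖∑ n ∈ s, (w (n / N) : ℂ) * ee (t * ν n)‖ ^ 4 with hF
  have hFc : Continuous F := by
    refine Continuous.pow (Continuous.norm (continuous_finsetSum _ fun m _ => ?_)) 4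
    exact continuous_const.mul (ee_comp_continuous (by fun_prop))
  have hNk : 0 < N ^ k := by positivity
  have hscale : ∀ (u : Finset ℕ) (γ : ℝ), cnt u ν γ = cnt u (fun n => (n:ℝ) ^ k) (γ * N ^ k) := by
    intro u γ
    rw [← cnt_scale u ν γ (N ^ k) hNk]
    congr 1
    ext n
    simp only [hν]
    rw [Real.div_rpow (by positivity) hN0.le, div_mul_cancel₀ _ hNk.ne']
  have hbase : ∫ t in (0:ℝ)..N, F t ≤ C0 * C2 * N ^ 4 := by
    have h1 := fourth_upper s (fun n => (w (n / N) : ℂ)) (fun p => by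
      rw [Complex.norm_real, Real.norm_eq_abs, abs_of_nonneg (hw0 _)]; exact hw1 _) ν N 0 N hN0 (by linarith) le_rfl hN0.le
    refine h1.trans ?_
    rw [hscale, show 1 / N * N ^ k = 1 * N ^ (k - 1) by rw [Real.rpow_sub hN0, Real.rpow_one]; ring]
    have h2 := htr N hN s (fun n hn => (hmem n).mp hn)
    calc _ ≤ C0 * N * (C2 * N ^ 3) := by gcongr
      _ = _ := by ring
  set Y := N ^ (1 / (1 + b)) with hY
  have hb1 : 0 < 1 + b := by linarith
  have hY1 : 1 ≤ Y := Real.one_le_rpow hN (by positivity)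
  have hYN : Y ≤ N := by
    nth_rw 1 [← Real.rpow_one N]
    refine Real.rpow_le_rpow_of_exponent_le hN ?_
    rw [div_le_one hb1]; linarith
  obtain ⟨K0, hK1, hK2⟩ := exists_nat_pow_near hY1 (show (1:ℝ) < 2 by norm_num)
  have hind : ∀ i ≤ K0, ∫ t in (0:ℝ)..(N * 2 ^ i), F t ≤ C0 * C2 * N ^ 4 + C1 * N ^ (3 + η) * (2 ^ i) ^ (1 + b) := by
    intro i
    induction i with
    | zero =>
      intro _
      rw [pow_zero, mul_one]
      have : 0 ≤ C1 * N ^ (3 + η) * 1 ^ (1 + b) := by positivity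
      linarith
    | succ i ih =>
      intro hi
      have ih := ih (by omega)
      have hpi : (2:ℝ) ^ i ≤ 2 ^ K0 := pow_le_pow_right₀ (by norm_num) (by omega)
      have h1 := hbl N hN (2 ^ i) (one_le_pow₀ (by norm_num)) (by linarith) s (fun n h1 h2 => (hmem n).mpr ⟨h1.le, h2.le⟩)
      have h2 : ∫ t in (0:ℝ)..(N * 2 ^ (i + 1)), F t = (∫ t in (0:ℝ)..(N * 2 ^ i), F t) + 
          ∫ t in (N * 2 ^ i)..(2 * (N * 2 ^ i)), F t := by
        rw [intervalIntegral.integral_add_adjacent_intervals (hFc.intervalIntegrable _ _) (hFc.intervalIntegrable _ _)]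
        congr 1; ring
      have h3 : 2 * ((2:ℝ) ^ i) ^ (1 + b) ≤ (2 ^ (i + 1)) ^ (1 + b) := by
        rw [pow_succ, mul_comm ((2:ℝ) ^ i) 2, Real.mul_rpow (by norm_num) (by positivity)]
        refine mul_le_mul_of_nonneg_right ?_ (by positivity)
        nth_rw 1 [← Real.rpow_one 2]
        exact Real.rpow_le_rpow_of_exponent_le (by norm_num) (by linarith)
      have h4 : C1 * N ^ (3 + η) * (2 * ((2:ℝ) ^ i) ^ (1 + b)) ≤ C1 * N ^ (3 + η) * (2 ^ (i + 1)) ^ (1 + b) :=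
        mul_le_mul_of_nonneg_left h3 (by positivity)
      rw [h2]
      have h1' : ∫ t in (N * 2 ^ i)..(2 * (N * 2 ^ i)), F t ≤ C1 * N ^ (3 + η) * (2 ^ i) ^ (1 + b) := h1
      linarith
  set T := N * 2 ^ K0 with hT
  have hT0 : 0 < T := by positivity
  have hTN2 : T ≤ N ^ 2 := by
    rw [hT, sq]; exact mul_le_mul_of_nonneg_left (hK1.trans hYN) hN0.le
  have hTY : N * Y ≤ 2 * T := by
    rw [hT]; rw [pow_succ] at hK2; nlinarith
  have hIntF : ∫ t in (0:ℝ)..T, F t ≤ (C0 * C2 + C1) * N ^ (4 + η) := by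
    refine (hind K0 le_rfl).trans ?_
    have h1 : ((2:ℝ) ^ K0) ^ (1 + b) ≤ N := by
      calc _ ≤ Y ^ (1 + b) := Real.rpow_le_rpow (by positivity) hK1 hb1.le
        _ = N := by rw [hY, ← Real.rpow_mul hN0.le, one_div_mul_cancel hb1.ne', Real.rpow_one]
    have h2 : N ^ 4 ≤ N ^ (4 + η) := by
      rw [← Real.rpow_natCast]; exact Real.rpow_le_rpow_of_exponent_le hN (by push_cast; linarith)
    have h3 : N ^ (4 + η) = N ^ (3 + η) * N := by
      rw [show 4 + η = (3 + η) + 1 by ring, Real.rpow_add hN0 (3 + η) 1, Real.rpow_one]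
    calc _ ≤ C0 * C2 * N ^ (4 + η) + C1 * N ^ (3 + η) * N := by gcongr
      _ = _ := by rw [h3]; ring
  have hlow := fourth_lower s s0 hss (fun n => w (n / N)) (fun p => hw0 _) (fun p hp => by
      obtain ⟨h1, h2⟩ := hs0 p hp
      exact (hwe _ ⟨by rwa [le_div_iff₀ hN0], by rwa [div_le_iff₀ hN0]⟩).ge) ν T hT0
  have hlow2 : T * cnt s0 ν (1 / (8 * T)) ≤ 4 * ((C0 * C2 + C1) * N ^ (4 + η)) :=
    hlow.trans (by have : (∫ t in (0:ℝ)..T, ‖∑ n ∈ s, ((w (n / N) : ℝ) : ℂ) * ee (t * ν n)‖ ^ 4) ≤ _ := hIntF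
                   linarith)
  have hc1 : (cnt s0 ν (1 / (8 * T)) : ℝ) ≤ 8 * (C0 * C2 + C1) * N ^ (2 + (b / (1 + b) + η)) := by
    have h1 : N * Y * cnt s0 ν (1 / (8 * T)) ≤ 8 * ((C0 * C2 + C1) * N ^ (4 + η)) := by
      have : N * Y * cnt s0 ν (1 / (8 * T)) ≤ 2 * T * cnt s0 ν (1 / (8 * T)) := by gcongr
      linarith
    have h2 : N ^ (4 + η) = N * Y * N ^ (2 + (b / (1 + b) + η)) := by
      rw [hY]
      nth_rw 2 [← Real.rpow_one N]
      rw [← Real.rpow_add hN0, ← Real.rpow_add hN0]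
      congr 1
      field_simp; ring
    rw [h2] at h1
    refine le_of_mul_le_mul_left ?_ (show 0 < N * Y by positivity)
    linarith
  have hen := cnt_enlarge s0 ν (1 / (8 * T)) (8 * T * Γ / N ^ 2) (by positivity) (by positivity)
  rw [show 8 * T * Γ / N ^ 2 * (1 / (8 * T)) = Γ / N ^ 2 by field_simp, hscale s0 (Γ / N ^ 2)] at hen
  have hΓe : Γ / N ^ 2 * N ^ k = Γ * N ^ (k - 2) := by
    rw [Real.rpow_sub hN0]; norm_cast; ring
  rw [hΓe] at hen
  refine hen.trans ?_
  have hl : 8 * T * Γ / N ^ 2 ≤ 8 * Γ := by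
    rw [div_le_iff₀ (by positivity)]; nlinarith
  calc _ ≤ (16 * Γ + 5) * (8 * (C0 * C2 + C1) * N ^ (2 + (b / (1 + b) + η))) := by
        refine mul_le_mul (by linarith) hc1 (by positivity) (by positivity)
    _ = _ := by ring

lemma HH_mono {b b' : ℝ} (h : b ≤ b') (hH : HH b) : HH b' := by
  intro k hk A B hA hAB Γ hΓ
  obtain ⟨C, hC, h1⟩ := hH k hk A B hA hAB Γ hΓ
  refine ⟨C, hC, fun N hN s hs => (h1 N hN s hs).trans ?_⟩
  exact mul_le_mul_of_nonneg_left (Real.rpow_le_rpow_of_exponent_le hN (by linarith)) hC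

lemma HH_all (ε : ℝ) (hε : 0 < ε) : HH ε := by
  set S := {b : ℝ | 0 ≤ b ∧ HH b} with hS
  have hne : S.Nonempty := ⟨2, by norm_num, HH_two⟩
  have hbd : BddBelow S := ⟨0, fun b hb => hb.1⟩
  set β := sInf S with hβ
  have hβ0 : 0 ≤ β := le_csInf hne fun b hb => hb.1
  have hle : β ≤ 0 := by
    by_contra hcon
    push Not at hcon
    have hd : 0 < β ^ 2 / 4 := by positivity
    obtain ⟨b, hb, hlt⟩ := exists_lt_of_csInf_lt hne (show sInf S < β + min (β ^ 2 / (4 * (1 + β))) β by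
      have : 0 < min (β ^ 2 / (4 * (1 + β))) β := lt_min (by positivity) hcon
      linarith)
    have hbβ : β ≤ b := csInf_le hbd hb
    have h1 : b < β + β ^ 2 / (4 * (1 + β)) := lt_of_lt_of_le hlt (by gcongr; exact min_le_left _ _)
    set η := β ^ 2 / (4 * (1 + β)) with hη
    have hη0 : 0 < η := by positivity
    have hstep := HH_step b hb.1 hb.2 η hη0
    have hmem : b / (1 + b) + η ∈ S := ⟨by have := hb.1; positivity, hstep⟩
    have h2 : β ≤ b / (1 + b) + η := csInf_le hbd hmem
    have h3 : b / (1 + b) = b - b ^ 2 / (1 + b) := by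
      have : 1 + b ≠ 0 := by linarith [hb.1]
      field_simp; ring
    have h4 : β ^ 2 / (1 + β) ≤ b ^ 2 / (1 + b) := by
      rw [div_le_div_iff₀ (by linarith) (by linarith)]
      nlinarith [mul_nonneg hβ0 (sub_nonneg.mpr hbβ), mul_nonneg (mul_nonneg hβ0 hb.1) (sub_nonneg.mpr hbβ), sq_nonneg (b - β)]
    have h5 : β ^ 2 / (1 + β) = 4 * η := by rw [hη]; field_simp
    linarith
  obtain ⟨b, hb, hlt⟩ := exists_lt_of_csInf_lt hne (show sInf S < ε by linarith)
  exact HH_mono hlt.le hb.2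

theorem robert_sargos_count (k ε : ℝ) (hk : 1 < k) (hε : 0 < ε) :
    ∃ C > 0, ∀ N ≥ (1 : ℝ), ∀ γ > (0 : ℝ),
      (Nat.card {v : ℕ × ℕ × ℕ × ℕ //
          (N < v.1 ∧ (v.1 : ℝ) ≤ 2 * N) ∧
          (N < v.2.1 ∧ (v.2.1 : ℝ) ≤ 2 * N) ∧
          (N < v.2.2.1 ∧ (v.2.2.1 : ℝ) ≤ 2 * N) ∧
          (N < v.2.2.2 ∧ (v.2.2.2 : ℝ) ≤ 2 * N) ∧
          |(v.1 : ℝ) ^ k + (v.2.1 : ℝ) ^ k - (v.2.2.1 : ℝ) ^ k - (v.2.2.2 : ℝ) ^ k| < γ} : ℝ)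
        ≤ C * (N ^ 2 + γ * N ^ (4 - k)) * N ^ ε := by
  obtain ⟨C, hC, h⟩ := HH_all ε hε k hk 1 2 one_pos one_lt_two 1 one_pos
  refine ⟨7 * C + 1, by positivity, fun N hN γ hγ => ?_⟩
  have hN0 : 0 < N := by linarith
  set s := (Finset.range (⌈2 * N⌉₊ + 1)).filter (fun n : ℕ => N < n ∧ (n:ℝ) ≤ 2 * N) with hs
  have hmem : ∀ n : ℕ, n ∈ s ↔ N < n ∧ (n:ℝ) ≤ 2 * N := by
    intro n
    rw [hs, Finset.mem_filter, Finset.mem_range, and_iff_right_iff_imp]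
    rintro ⟨_, h⟩
    have h2 : (n:ℝ) ≤ (⌈2 * N⌉₊ : ℝ) := h.trans (Nat.le_ceil _)
    have : n ≤ ⌈2 * N⌉₊ := by exact_mod_cast h2
    omega
  have hcard : Nat.card {v : ℕ × ℕ × ℕ × ℕ //
          (N < v.1 ∧ (v.1 : ℝ) ≤ 2 * N) ∧
          (N < v.2.1 ∧ (v.2.1 : ℝ) ≤ 2 * N) ∧
          (N < v.2.2.1 ∧ (v.2.2.1 : ℝ) ≤ 2 * N) ∧
          (N < v.2.2.2 ∧ (v.2.2.2 : ℝ) ≤ 2 * N) ∧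
          |(v.1 : ℝ) ^ k + (v.2.1 : ℝ) ^ k - (v.2.2.1 : ℝ) ^ k - (v.2.2.2 : ℝ) ^ k| < γ} ≤ cnt s (fun n => (n:ℝ) ^ k) γ := by
    unfold cnt
    rw [← Nat.card_eq_finsetCard]
    refine Nat.card_le_card_of_injective (fun v => ⟨((v.1.1, v.1.2.1), (v.1.2.2.1, v.1.2.2.2)), ?_⟩) ?_
    · obtain ⟨v, h1, h2, h3, h4, h5⟩ := v
      rw [Finset.mem_filter, Finset.mem_product, Finset.mem_product, Finset.mem_product]
      refine ⟨⟨⟨(hmem _).mpr h1, (hmem _).mpr h2⟩, ⟨(hmem _).mpr h3, (hmem _).mpr h4⟩⟩, ?_⟩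
      refine le_trans (le_of_eq ?_) h5.le
      congr 1; ring
    · rintro ⟨⟨a, b, c, d⟩, hv⟩ ⟨⟨a', b', c', d'⟩, hv'⟩ he
      simp only [Subtype.mk.injEq, Prod.mk.injEq] at he ⊢
      tauto
  have hbase := h N hN s (fun n hn => by
    obtain ⟨h1, h2⟩ := (hmem n).mp hn
    exact ⟨by linarith, h2⟩)
  rw [one_mul] at hbase
  set g := N ^ (k - 2) with hg
  have hg0 : 0 < g := by positivity
  set l := γ / g with hl
  have hl0 : 0 < l := by positivity
  have h2 : N ^ (2 + ε) = N ^ 2 * N ^ ε := by rw [Real.rpow_add hN0]; norm_cast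
  have h3 : l * N ^ 2 = γ * N ^ (4 - k) := by
    rw [hl, hg, show 4 - k = 2 - (k - 2) by ring, Real.rpow_sub hN0 2 (k - 2)]
    norm_cast; ring
  have hcnt : (cnt s (fun n => (n:ℝ) ^ k) γ : ℝ) ≤ (2 * l + 5) * (C * N ^ (2 + ε)) := by
    have h1 := cnt_enlarge s (fun n => (n:ℝ) ^ k) g l hg0 hl0.le
    rw [show l * g = γ by rw [hl]; field_simp] at h1
    refine h1.trans ?_
    gcongr
  calc _ ≤ (cnt s (fun n => (n:ℝ) ^ k) γ : ℝ) := by exact_mod_cast hcard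
    _ ≤ (2 * l + 5) * (C * N ^ (2 + ε)) := hcnt
    _ = C * (5 * N ^ 2 + 2 * (l * N ^ 2)) * N ^ ε := by rw [h2]; ring
    _ ≤ C * (7 * N ^ 2 + 7 * (l * N ^ 2)) * N ^ ε := by
        have : 0 ≤ l * N ^ 2 := by positivity
        have : 0 ≤ N ^ 2 := by positivity
        gcongr <;> norm_num
    _ = 7 * C * (N ^ 2 + γ * N ^ (4 - k)) * N ^ ε := by rw [h3]; ring
    _ ≤ _ := by
        have : 0 ≤ N ^ (4 - k) := by positivity
        gcongr; linarith
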